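/- arXiv:1701.08004 — 8 statements merged into one kernel-verified Lean document; each statement's English description precedes it below -/
import Mathlib

section
/- Assume the structure equations (S1)–(S3) hold, that ∂F/∂z_k is nowhere zero, that f11′(z0)² + f31′(z0)² ≠ 0 for every z0, and that f11·f22 − η·f12 is nowhere zero on ℝ^{k+1}. Assume moreover that the data belongs to one of the following five groups: (I) there is ε ∈ {1,−1} with f31 = ε·f11, f32 = ε·f12, f11 nowhere zero, and f22 identically equal to a constant β; (II) there is a constant λ with λ ≠ 0, λ² ≠ 1, f31 = λ·f11 and f11 nowhere zero; (III) f11 ≡ 0 or f31 ≡ 0; (IV) f31² − f11² is identically equal to a nonzero constant C and L := f11·f31′ − f31·f11′ is nowhere zero; (V) H := f11·f11′ − f31·f31′ and L := f11·f31′ − f31·f11′ are both nowhere zero. If there exist smooth functions a, b, c on a nonempty open connected set U ⊆ ℝ² satisfying the Codazzi identities (C1), (C2) and the Gauss equation a·c − b² = −1, then the data is in group (I), and there exist constants γ, l ∈ ℝ such that for all (x,t) ∈ U, writing s = ε·(η·x + β·t): b(x,t) = γ·e^{2s}, a(x,t)² = l·e^{2s} − γ²·e^{4s} − 1 with a nowhere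 zero on U, and c = (b² − 1)/a; in particular a, b, c are universal functions of η·x + β·t. -/
open Real Finset

/-- Partial derivative of `f` at `z` in the `i`-th coordinate direction. -/
noncomputable def pd {n : ℕ} (f : (Fin n → ℝ) → ℝ) (z : Fin n → ℝ) (i : ℕ) : ℝ :=
  fderiv ℝ f z (fun j => if (j : ℕ) = i then 1 else 0)

/-- The `i`-th coordinate of `z` (junk value `0` out of range). -/
def zc {n : ℕ} (z : Fin n → ℝ) (i : ℕ) : ℝ :=
  if h : i < n then z ⟨i, h⟩ else 0

/-- `f` depends only on the first `m` coordinates `z_0, …, z_{m-1}`. -/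
def DependsOnFirst {n : ℕ} (m : ℕ) (f : (Fin n → ℝ) → ℝ) : Prop :=
  ∀ z w : Fin n → ℝ, (∀ j : Fin n, (j : ℕ) < m → z j = w j) → f z = f w

/-- The structure equations (S1)–(S3), required at every point `(z_0, …, z_k) ∈ ℝ^{k+1}`. -/
def StructEqs (k : ℕ) (η : ℝ) (f11 f31 : ℝ → ℝ)
    (f12 f22 f32 F : (Fin (k+1) → ℝ) → ℝ) : Prop :=
  ∀ z : Fin (k+1) → ℝ,
    deriv f11 (z 0) * F z =
      (∑ i ∈ Finset.range k, pd f12 z i * zc z (i+1)) + η * f32 z - f31 (z 0) * f22 z ∧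
    (∑ i ∈ Finset.range (k-1), pd f22 z i * zc z (i+1)) =
      f11 (z 0) * f32 z - f31 (z 0) * f12 z ∧
    deriv f31 (z 0) * F z =
      (∑ i ∈ Finset.range k, pd f32 z i * zc z (i+1)) + η * f12 z - f11 (z 0) * f22 z

/-- The Codazzi identities (C1) and (C2), required for every `(x,t) ∈ U` and every
`(z_0, …, z_{k-1})` (equivalently, every `z ∈ ℝ^{k+1}` since the data does not
depend on `z_k`).  Here `(1,0)` is the `∂/∂x` direction and `(0,1)` the `∂/∂t` one. -/
def Codazzi (k : ℕ) (η : ℝ) (f11 f31 : ℝ → ℝ) (f12 f22 f32 : (Fin (k+1) → ℝ) → ℝ)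
    (U : Set (ℝ × ℝ)) (a b c : ℝ × ℝ → ℝ) : Prop :=
  ∀ p ∈ U, ∀ z : Fin (k+1) → ℝ,
    f11 (z 0) * fderiv ℝ a p (0, 1) + η * fderiv ℝ b p (0, 1)
      - f12 z * fderiv ℝ a p (1, 0) - f22 z * fderiv ℝ b p (1, 0)
      - 2 * b p * (f11 (z 0) * f32 z - f31 (z 0) * f12 z)
      + (a p - c p) * (η * f32 z - f31 (z 0) * f22 z) = 0 ∧
    f11 (z 0) * fderiv ℝ b p (0, 1) + η * fderiv ℝ c p (0, 1)
      - f12 z * fderiv ℝ b p (1, 0) - f22 z * fderiv ℝ c p (1, 0)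
      + (a p - c p) * (f11 (z 0) * f32 z - f31 (z 0) * f12 z)
      + 2 * b p * (η * f32 z - f31 (z 0) * f22 z) = 0

lemma hasDerivAt_pd {n : ℕ} {f : (Fin n → ℝ) → ℝ} (hf : Differentiable ℝ f)
    (z : Fin n → ℝ) (i : ℕ) :
    HasDerivAt (fun τ : ℝ => f (z + τ • fun j : Fin n => if (j : ℕ) = i then (1 : ℝ) else 0))
      (pd f z i) 0 :=
  (hf z).hasFDerivAt.hasLineDerivAt _

lemma DependsOnFirst.apply_add_smul {n m i : ℕ} {f : (Fin n → ℝ) → ℝ} (hf : DependsOnFirst m f)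
    (hi : m ≤ i) (z : Fin n → ℝ) (τ : ℝ) :
    f (z + τ • fun j : Fin n => if (j : ℕ) = i then (1 : ℝ) else 0) = f z := by
  refine hf _ _ fun j hj => ?_
  have : (j : ℕ) ≠ i := by omega
  simp [this]

lemma DependsOnFirst.pd_add_smul {n m i : ℕ} {f : (Fin n → ℝ) → ℝ} (hf : DependsOnFirst m f)
    (hi : m ≤ i) (z : Fin n → ℝ) (τ : ℝ) (l : ℕ) :
    pd f (z + τ • fun j : Fin n => if (j : ℕ) = i then (1 : ℝ) else 0) l = pd f z l := by
  unfold pd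
  rw [← fderiv_comp_add_right]
  simp only [hf.apply_add_smul hi]

/-- The top-order parts of (S1) and (S3): the derivatives of `f12` and `f32` in the direction
`z_{k-1}` are proportional to `f11'` and `f31'` with the same nonzero factor. -/
lemma StructEqs.exists_pd_eq {k : ℕ} (hk : 1 ≤ k) {η : ℝ} {f11 f31 : ℝ → ℝ}
    {f12 f22 f32 F : (Fin (k+1) → ℝ) → ℝ} (hS : StructEqs k η f11 f31 f12 f22 f32 F)
    (hF : Differentiable ℝ F)
    (hdep12 : DependsOnFirst k f12) (hdep32 : DependsOnFirst k f32)
    (hdep22 : DependsOnFirst (k-1) f22) (z : Fin (k+1) → ℝ) (hFk : pd F z k ≠ 0)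
    (hnondeg : (deriv f11 (z 0)) ^ 2 + (deriv f31 (z 0)) ^ 2 ≠ 0) :
    ∃ δ : ℝ, δ ≠ 0 ∧ pd f12 z (k-1) = deriv f11 (z 0) * δ ∧
      pd f32 z (k-1) = deriv f31 (z 0) * δ := by
  obtain ⟨m, rfl⟩ : ∃ m, k = m + 1 := ⟨k - 1, by omega⟩
  simp only [Nat.add_sub_cancel] at hdep22 ⊢
  set v : Fin (m+1+1) → ℝ := fun j => if (j : ℕ) = m + 1 then (1 : ℝ) else 0 with hv
  have hz0 (τ : ℝ) : (z + τ • v) 0 = z 0 := by simp [hv]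
  have hzc (τ : ℝ) (i : ℕ) (hi : i < m) : zc (z + τ • v) (i+1) = zc z (i+1) := by
    have h2 : i ≠ m := by omega
    simp [zc, hv, h2]
  have hzm (τ : ℝ) : zc (z + τ • v) (m+1) = zc z (m+1) + τ := by simp [zc, hv]
  have hsum (f : (Fin (m+1+1) → ℝ) → ℝ) (hf : DependsOnFirst (m+1) f) (τ : ℝ) :
      ∑ i ∈ Finset.range (m+1), pd f (z + τ • v) i * zc (z + τ • v) (i+1) =
        ∑ i ∈ Finset.range (m+1), pd f z i * zc z (i+1) + τ * pd f z m := by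
    simp only [hv, hf.pd_add_smul le_rfl]
    simp only [← hv]
    rw [Finset.sum_range_succ, Finset.sum_range_succ, hzm,
      Finset.sum_congr rfl fun i hi => by rw [hzc τ i (Finset.mem_range.mp hi)]]
    ring
  have key (τ : ℝ) : deriv f11 (z 0) * (F (z + τ • v) - F z) = τ * pd f12 z m ∧
      deriv f31 (z 0) * (F (z + τ • v) - F z) = τ * pd f32 z m := by
    obtain ⟨h1, -, h3⟩ := hS z
    obtain ⟨h1', -, h3'⟩ := hS (z + τ • v)
    rw [hsum _ ‹_›, hz0] at h1' h3'
    have e12 : f12 (z + τ • v) = f12 z := hdep12.apply_add_smul le_rfl z τ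
    have e32 : f32 (z + τ • v) = f32 z := hdep32.apply_add_smul le_rfl z τ
    have e22 : f22 (z + τ • v) = f22 z := hdep22.apply_add_smul (Nat.le_succ m) z τ
    rw [e22, e32] at h1'
    rw [e22, e12] at h3'
    exact ⟨by linear_combination h1' - h1, by linear_combination h3' - h3⟩
  refine ⟨F (z + (1 : ℝ) • v) - F z, fun hδ => hFk ?_, ?_, ?_⟩
  · have h12 : pd f12 z m = 0 := by linear_combination deriv f11 (z 0) * hδ - (key 1).1
    have h32 : pd f32 z m = 0 := by linear_combination deriv f31 (z 0) * hδ - (key 1).2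
    have hconst (τ : ℝ) : F (z + τ • v) = F z := by
      have h1 := (key τ).1
      have h3 := (key τ).2
      rw [h12] at h1
      rw [h32] at h3
      refine sub_eq_zero.mp ((mul_eq_zero.mp ?_).resolve_left hnondeg)
      linear_combination deriv f11 (z 0) * h1 + deriv f31 (z 0) * h3
    have hd := hasDerivAt_pd hF z (m+1)
    simp only [← hv, hconst] at hd
    exact hd.unique (hasDerivAt_const _ _)
  · linear_combination -(key 1).1
  · linear_combination -(key 1).2

/-- At a jet with vanishing derivatives, (S1)–(S3) force `f11 f11' = f31 f31'`. -/
lemma StructEqs.mul_deriv_eq {k : ℕ} {η : ℝ} {f11 f31 : ℝ → ℝ}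
    {f12 f22 f32 F : (Fin (k+1) → ℝ) → ℝ} (hS : StructEqs k η f11 f31 f12 f22 f32 F)
    (hΔ : ∀ z : Fin (k+1) → ℝ, f11 (z 0) * f22 z - η * f12 z ≠ 0) (z0 : ℝ) :
    f11 z0 * deriv f11 z0 = f31 z0 * deriv f31 z0 := by
  set z : Fin (k+1) → ℝ := fun j => if j = 0 then z0 else 0 with hz
  have hz0 : z 0 = z0 := by simp [hz]
  have hzc (i : ℕ) : zc z (i+1) = 0 := by simp only [zc, hz, Fin.ext_iff]; split_ifs <;> simp_all
  obtain ⟨h1, h2, h3⟩ := hS z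
  have hΔz := hΔ z
  simp only [hzc, mul_zero, Finset.sum_const_zero, hz0] at h1 h2 h3 hΔz
  have hFz : F z ≠ 0 := fun h => hΔz (by rw [h] at h3; linear_combination h3)
  refine mul_right_cancel₀ hFz ?_
  linear_combination f11 z0 * h1 - f31 z0 * h3 - η * h2

/-- The top-order parts of the Codazzi identities. -/
lemma Codazzi.top_order {k : ℕ} (hk : 2 ≤ k) {η : ℝ} {f11 f31 : ℝ → ℝ}
    {f12 f22 f32 : (Fin (k+1) → ℝ) → ℝ} {U : Set (ℝ × ℝ)} {a b c : ℝ × ℝ → ℝ}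
    (hCod : Codazzi k η f11 f31 f12 f22 f32 U a b c)
    (hf12 : Differentiable ℝ f12) (hf32 : Differentiable ℝ f32)
    (hdep22 : DependsOnFirst (k-1) f22) {z : Fin (k+1) → ℝ} {δ : ℝ} (hδ : δ ≠ 0)
    (h12 : pd f12 z (k-1) = deriv f11 (z 0) * δ) (h32 : pd f32 z (k-1) = deriv f31 (z 0) * δ)
    {p : ℝ × ℝ} (hp : p ∈ U) :
    -(fderiv ℝ a p (1, 0) * deriv f11 (z 0))
        - 2 * b p * (f11 (z 0) * deriv f31 (z 0) - f31 (z 0) * deriv f11 (z 0))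
        + (a p - c p) * η * deriv f31 (z 0) = 0 ∧
      -(fderiv ℝ b p (1, 0) * deriv f11 (z 0))
        + (a p - c p) * (f11 (z 0) * deriv f31 (z 0) - f31 (z 0) * deriv f11 (z 0))
        + 2 * b p * η * deriv f31 (z 0) = 0 := by
  set v : Fin (k+1) → ℝ := fun j => if (j : ℕ) = k - 1 then (1 : ℝ) else 0 with hv
  have hz0 (τ : ℝ) : (z + τ • v) 0 = z 0 := by
    have : 0 ≠ k - 1 := by omega
    simp [hv, this]
  have h22 (τ : ℝ) : f22 (z + τ • v) = f22 z := hdep22.apply_add_smul le_rfl z τ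
  have hlin (α β : ℝ)
      (h : ∀ τ : ℝ, α * f12 (z + τ • v) + β * f32 (z + τ • v) = α * f12 z + β * f32 z) :
      α * deriv f11 (z 0) + β * deriv f31 (z 0) = 0 := by
    have hd := ((hasDerivAt_pd hf12 z (k-1)).const_mul α).add
      ((hasDerivAt_pd hf32 z (k-1)).const_mul β)
    have hd' := hd.unique ((hasDerivAt_const (0 : ℝ) (α * f12 z + β * f32 z)).congr_of_eventuallyEq
      (Filter.Eventually.of_forall h))
    rw [h12, h32] at hd'
    refine mul_right_cancel₀ hδ ?_
    linear_combination hd'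
  have hC := hCod p hp z
  constructor
  · linear_combination hlin (-fderiv ℝ a p (1, 0) + 2 * b p * f31 (z 0))
      (-2 * b p * f11 (z 0) + (a p - c p) * η) fun τ => by
        have h := (hCod p hp (z + τ • v)).1
        rw [h22, hz0] at h
        linear_combination h - hC.1
  · linear_combination hlin (-fderiv ℝ b p (1, 0) - (a p - c p) * f31 (z 0))
      ((a p - c p) * f11 (z 0) + 2 * b p * η) fun τ => by
        have h := (hCod p hp (z + τ • v)).2
        rw [h22, hz0] at h
        linear_combination h - hC.2

/-- Functions `u, v` with `v ^ 2 - u ^ 2` constant and nowhere vanishing Wronskian `L`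
do not admit a linear relation of the form occurring in the Codazzi identities. -/
lemma eq_zero_of_hyperbola_relation {u v : ℝ → ℝ} (hu : Differentiable ℝ u)
    (hv : Differentiable ℝ v) {C : ℝ} (huv : ∀ x, v x ^ 2 - u x ^ 2 = C)
    (hH : ∀ x, u x * deriv u x = v x * deriv v x)
    (hL : ∀ x, u x * deriv v x - v x * deriv u x ≠ 0) {A B D : ℝ}
    (h : ∀ x, A * deriv u x + B * (u x * deriv v x - v x * deriv u x) + D * deriv v x = 0) :
    B = 0 := by
  have h0 (x : ℝ) : -A * v x + -D * u x = -B * C := by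
    refine mul_right_cancel₀ (hL x) ?_
    linear_combination C * h x + (A * deriv u x + D * deriv v x) * huv x
      + (A * u x + D * v x) * hH x
  have h1 (x : ℝ) : -A * deriv v x + -D * deriv u x = 0 := by
    have hd := ((hv x).hasDerivAt.const_mul (-A)).add ((hu x).hasDerivAt.const_mul (-D))
    exact hd.unique ((hasDerivAt_const x (-B * C)).congr_of_eventuallyEq
      (Filter.Eventually.of_forall h0))
  have h2 (x : ℝ) : -A * u x + -D * v x = 0 := by
    refine mul_right_cancel₀ (hL x) ?_
    linear_combination -C * h1 x + (A * deriv v x + D * deriv u x) * huv x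
      + (A * v x + D * u x) * hH x
  have h3 : -A * deriv u 0 + -D * deriv v 0 = 0 := by
    have hd := ((hu 0).hasDerivAt.const_mul (-A)).add ((hv 0).hasDerivAt.const_mul (-D))
    exact hd.unique ((hasDerivAt_const (0 : ℝ) (0 : ℝ)).congr_of_eventuallyEq
      (Filter.Eventually.of_forall h2))
  refine (mul_eq_zero.mp ?_).resolve_right (hL 0)
  linear_combination h 0 + h3

/-- A solution of `∇f = (2 ε η f, 2 ε β f)` on a connected open set is a multiple of
`exp (2 ε (η x + β t))`. -/
lemma exists_eq_mul_exp {U : Set (ℝ × ℝ)} (hU : IsOpen U) (hUc : IsPreconnected U)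
    {f : ℝ × ℝ → ℝ} (hf : DifferentiableOn ℝ f U) {ε η β : ℝ}
    (hx : ∀ p ∈ U, fderiv ℝ f p (1, 0) = 2 * ε * η * f p)
    (ht : ∀ p ∈ U, fderiv ℝ f p (0, 1) = 2 * ε * β * f p) :
    ∃ γ : ℝ, ∀ p ∈ U, f p = γ * Real.exp (2 * (ε * (η * p.1 + β * p.2))) := by
  have hE (p : ℝ × ℝ) : HasFDerivAt (fun q : ℝ × ℝ => Real.exp (-(2 * (ε * (η * q.1 + β * q.2)))))
      (Real.exp (-(2 * (ε * (η * p.1 + β * p.2)))) • -((2 : ℝ) • (ε •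
        (η • ContinuousLinearMap.fst ℝ ℝ ℝ + β • ContinuousLinearMap.snd ℝ ℝ ℝ)))) p :=
    (((hasFDerivAt_fst.const_mul η).add
      (hasFDerivAt_snd.const_mul β)).const_mul ε |>.const_mul 2).neg.exp
  have hd (p : ℝ × ℝ) (hp : p ∈ U) :=
    ((hf p hp).differentiableAt (hU.mem_nhds hp)).hasFDerivAt.mul (hE p)
  obtain ⟨γ, hγ⟩ := hU.exists_is_const_of_fderiv_eq_zero hUc
    (fun p hp => (hd p hp).differentiableAt.differentiableWithinAt) (fun p hp => by
      rw [(hd p hp).fderiv]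
      ext <;> simp [hx p hp, ht p hp] <;> ring)
  refine ⟨γ, fun p hp => ?_⟩
  have h := hγ p hp
  simp only [Pi.mul_apply, Real.exp_neg] at h
  rw [← h, inv_mul_cancel_right₀ (Real.exp_ne_zero _)]

/-- The Codazzi and Gauss equations for data in group (I). -/
lemma codazzi_solution_of_proportional {U : Set (ℝ × ℝ)} (hU : IsOpen U) (hUc : IsPreconnected U)
    {a b c : ℝ × ℝ → ℝ} (ha : DifferentiableOn ℝ a U) (hb : DifferentiableOn ℝ b U)
    (hc : DifferentiableOn ℝ c U) {ε η β : ℝ} (hε : ε ≠ 0) (hη : η ≠ 0)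
    (hGauss : ∀ p ∈ U, a p * c p - (b p) ^ 2 = -1)
    (hax : ∀ p ∈ U, fderiv ℝ a p (1, 0) = ε * η * (a p - c p))
    (hat : ∀ p ∈ U, fderiv ℝ a p (0, 1) = ε * β * (a p - c p))
    (hbx : ∀ p ∈ U, fderiv ℝ b p (1, 0) = 2 * ε * η * b p)
    (hbt : ∀ p ∈ U, fderiv ℝ b p (0, 1) = 2 * ε * β * b p) :
    ∃ γ l : ℝ, ∀ p ∈ U,
      b p = γ * Real.exp (2 * (ε * (η * p.1 + β * p.2))) ∧
      a p ≠ 0 ∧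
      (a p) ^ 2 = l * Real.exp (2 * (ε * (η * p.1 + β * p.2)))
        - γ ^ 2 * Real.exp (4 * (ε * (η * p.1 + β * p.2))) - 1 ∧
      c p = ((b p) ^ 2 - 1) / a p := by
  have hda (p) (hp : p ∈ U) := ((ha p hp).differentiableAt (hU.mem_nhds hp)).hasFDerivAt
  have hdb (p) (hp : p ∈ U) := ((hb p hp).differentiableAt (hU.mem_nhds hp)).hasFDerivAt
  have hdc (p) (hp : p ∈ U) := ((hc p hp).differentiableAt (hU.mem_nhds hp)).hasFDerivAt
  have hw (p) (hp : p ∈ U) := (((hda p hp).pow 2).add ((hdb p hp).pow 2)).add_const (1 : ℝ)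
  obtain ⟨γ, hγ⟩ := exists_eq_mul_exp hU hUc hb hbx hbt
  obtain ⟨l, hl⟩ := exists_eq_mul_exp (f := fun p => a p ^ 2 + b p ^ 2 + 1)
    (ε := ε) (η := η) (β := β) hU hUc
    (fun p hp => (hw p hp).differentiableAt.differentiableWithinAt)
    (fun p hp => by
      refine (congrArg (· (1, 0)) (hw p hp).fderiv).trans ?_
      simp [hax p hp, hbx p hp]
      linear_combination (-2 * ε * η) * hGauss p hp)
    (fun p hp => by
      refine (congrArg (· (0, 1)) (hw p hp).fderiv).trans ?_
      simp [hat p hp, hbt p hp]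
      linear_combination (-2 * ε * β) * hGauss p hp)
  have ha0 (p) (hp : p ∈ U) : a p ≠ 0 := fun h0 => by
    have hd := (((hda p hp).mul (hdc p hp)).sub ((hdb p hp).pow 2)).congr_of_eventuallyEq
      (f₁ := fun _ => (-1 : ℝ))
      (Filter.eventuallyEq_of_mem (hU.mem_nhds hp) fun q hq => (hGauss q hq).symm)
    have h := congrArg (· (1, 0)) (hd.unique (hasFDerivAt_const (-1 : ℝ) p))
    simp [hax p hp, hbx p hp, h0] at h
    have hG := hGauss p hp
    rw [h0] at hG
    have : ε * η * (c p ^ 2 + 4 * b p ^ 2) = 0 := by linear_combination -h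
    have : c p ^ 2 + 4 * b p ^ 2 = 0 :=
      (mul_eq_zero.mp this).resolve_left (mul_ne_zero hε hη)
    nlinarith [sq_nonneg (c p)]
  refine ⟨γ, l, fun p hp => ⟨hγ p hp, ha0 p hp, ?_, ?_⟩⟩
  · have hexp : Real.exp (4 * (ε * (η * p.1 + β * p.2))) =
        Real.exp (2 * (ε * (η * p.1 + β * p.2))) ^ 2 := by
      rw [← Real.exp_nat_mul]; congr 1; push_cast; ring
    have h1 := hl p hp
    have h2 := hγ p hp
    rw [hexp, ← h1]
    rw [← mul_pow, ← h2]
    ring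
  · rw [eq_div_iff (ha0 p hp)]
    linear_combination hGauss p hp

/-- Under the structure equations, the nondegeneracy conditions, and the
assumption that the data lies in one of the five groups I–V of the Chern–Tenenblat
classification, if smooth `a, b, c` on a nonempty open connected `U ⊆ ℝ²` satisfy the
Codazzi identities and the Gauss equation, then the data is in group I and `a, b, c` are
the universal functions of `η·x + β·t` displayed below. -/
theorem stmt0 (k : ℕ) (hk : 2 ≤ k) (η : ℝ) (hη : η ≠ 0)
    (f11 f31 : ℝ → ℝ) (f12 f22 f32 F : (Fin (k+1) → ℝ) → ℝ)
    (hf11 : ContDiff ℝ (⊤ : ℕ∞) f11) (hf31 : ContDiff ℝ (⊤ : ℕ∞) f31)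
    (hf12 : ContDiff ℝ (⊤ : ℕ∞) f12) (hf22 : ContDiff ℝ (⊤ : ℕ∞) f22)
    (hf32 : ContDiff ℝ (⊤ : ℕ∞) f32) (hF : ContDiff ℝ (⊤ : ℕ∞) F)
    (hdep12 : DependsOnFirst k f12) (hdep32 : DependsOnFirst k f32)
    (hdep22 : DependsOnFirst (k-1) f22)
    (hS : StructEqs k η f11 f31 f12 f22 f32 F)
    (hFk : ∀ z : Fin (k+1) → ℝ, pd F z k ≠ 0)
    (hnondeg : ∀ z0 : ℝ, (deriv f11 z0) ^ 2 + (deriv f31 z0) ^ 2 ≠ 0)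
    (hΔ : ∀ z : Fin (k+1) → ℝ, f11 (z 0) * f22 z - η * f12 z ≠ 0)
    (hgroup :
      -- Group I
      (∃ ε : ℝ, (ε = 1 ∨ ε = -1) ∧ (∀ z0 : ℝ, f31 z0 = ε * f11 z0) ∧
        (∀ z : Fin (k+1) → ℝ, f32 z = ε * f12 z) ∧ (∀ z0 : ℝ, f11 z0 ≠ 0) ∧
        (∃ β : ℝ, ∀ z : Fin (k+1) → ℝ, f22 z = β)) ∨
      -- Group II
      (∃ lam : ℝ, lam ≠ 0 ∧ lam ^ 2 ≠ 1 ∧ (∀ z0 : ℝ, f31 z0 = lam * f11 z0) ∧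
        (∀ z0 : ℝ, f11 z0 ≠ 0)) ∨
      -- Group III
      ((∀ z0 : ℝ, f11 z0 = 0) ∨ (∀ z0 : ℝ, f31 z0 = 0)) ∨
      -- Group IV
      (∃ C : ℝ, C ≠ 0 ∧ (∀ z0 : ℝ, (f31 z0) ^ 2 - (f11 z0) ^ 2 = C) ∧
        (∀ z0 : ℝ, f11 z0 * deriv f31 z0 - f31 z0 * deriv f11 z0 ≠ 0)) ∨
      -- Group V
      ((∀ z0 : ℝ, f11 z0 * deriv f11 z0 - f31 z0 * deriv f31 z0 ≠ 0) ∧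
       (∀ z0 : ℝ, f11 z0 * deriv f31 z0 - f31 z0 * deriv f11 z0 ≠ 0)))
    (U : Set (ℝ × ℝ)) (hUopen : IsOpen U) (hUne : U.Nonempty) (hUconn : IsConnected U)
    (a b c : ℝ × ℝ → ℝ)
    (ha : ContDiffOn ℝ (⊤ : ℕ∞) a U) (hb : ContDiffOn ℝ (⊤ : ℕ∞) b U)
    (hc : ContDiffOn ℝ (⊤ : ℕ∞) c U)
    (hCod : Codazzi k η f11 f31 f12 f22 f32 U a b c)
    (hGauss : ∀ p ∈ U, a p * c p - (b p) ^ 2 = -1) :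
    ∃ ε : ℝ, (ε = 1 ∨ ε = -1) ∧ (∀ z0 : ℝ, f31 z0 = ε * f11 z0) ∧
      (∀ z : Fin (k+1) → ℝ, f32 z = ε * f12 z) ∧ (∀ z0 : ℝ, f11 z0 ≠ 0) ∧
      ∃ β γ l : ℝ, (∀ z : Fin (k+1) → ℝ, f22 z = β) ∧
        ∀ p ∈ U,
          b p = γ * Real.exp (2 * (ε * (η * p.1 + β * p.2))) ∧
          a p ≠ 0 ∧
          (a p) ^ 2 = l * Real.exp (2 * (ε * (η * p.1 + β * p.2)))
            - γ ^ 2 * Real.exp (4 * (ε * (η * p.1 + β * p.2))) - 1 ∧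
          c p = ((b p) ^ 2 - 1) / a p := by
  have hd11 : Differentiable ℝ f11 := hf11.differentiable (by simp)
  have hd31 : Differentiable ℝ f31 := hf31.differentiable (by simp)
  have hH := hS.mul_deriv_eq hΔ
  choose δ hδ h12 h32 using fun z0 : ℝ => hS.exists_pd_eq (by omega)
    (hF.differentiable (by simp)) hdep12 hdep32 hdep22 (fun _ => z0) (hFk _) (hnondeg z0)
  have htop (p : ℝ × ℝ) (hp : p ∈ U) (z0 : ℝ) :=
    hCod.top_order hk (hf12.differentiable (by simp)) (hf32.differentiable (by simp))
      hdep22 (hδ z0) (h12 z0) (h32 z0) hp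
  rcases hgroup with ⟨ε, hε, h31, h32, h11, β, h22⟩ | ⟨lam, -, hlam, h31, h11⟩ | (h0 | h0) |
    ⟨C, -, hhyp, hL⟩ | ⟨hH', -⟩
  · refine ⟨ε, hε, h31, h32, h11, β, ?_⟩
    have hε0 : ε ≠ 0 := by rcases hε with rfl | rfl <;> norm_num
    have hd : ∀ x, deriv f31 x = ε * deriv f11 x := fun x => by
      rw [funext h31, deriv_const_mul _ (hd11 x)]
    have hd0 : ∀ x, deriv f11 x ≠ 0 := fun x h => hnondeg x (by rw [hd, h]; ring)
    have hinj : ∃ x, f11 x ≠ f11 0 := by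
      by_contra! h
      exact hd0 0 (by rw [funext h]; simp)
    obtain ⟨x, hx⟩ := hinj
    have hCt (p : ℝ × ℝ) (hp : p ∈ U) :
        fderiv ℝ a p (1, 0) = ε * η * (a p - c p) ∧ fderiv ℝ b p (1, 0) = 2 * ε * η * b p ∧
        fderiv ℝ a p (0, 1) = ε * β * (a p - c p) ∧ fderiv ℝ b p (0, 1) = 2 * ε * β * b p := by
      obtain ⟨e1, e2⟩ := htop p hp 0
      have hax : fderiv ℝ a p (1, 0) = ε * η * (a p - c p) := by
        refine mul_right_cancel₀ (hd0 0) ?_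
        simp only [hd, h31] at e1
        linear_combination -e1
      have hbx : fderiv ℝ b p (1, 0) = 2 * ε * η * b p := by
        refine mul_right_cancel₀ (hd0 0) ?_
        simp only [hd, h31] at e2
        linear_combination -e2
      obtain ⟨p1, p2⟩ := hCod p hp fun _ => 0
      obtain ⟨q1, q2⟩ := hCod p hp fun _ => x
      simp only [h31, h32, h22, hax, hbx] at p1 p2 q1 q2
      refine ⟨hax, hbx, mul_left_cancel₀ (sub_ne_zero.mpr hx) ?_,
        mul_left_cancel₀ (sub_ne_zero.mpr hx) ?_⟩
      · linear_combination q1 - p1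
      · linear_combination q2 - p2
    obtain ⟨γ, l, h⟩ := codazzi_solution_of_proportional hUopen hUconn.isPreconnected
      (ha.differentiableOn (by simp)) (hb.differentiableOn (by simp))
      (hc.differentiableOn (by simp)) hε0 hη hGauss (fun p hp => (hCt p hp).1)
      (fun p hp => (hCt p hp).2.2.1) (fun p hp => (hCt p hp).2.1) (fun p hp => (hCt p hp).2.2.2)
    exact ⟨γ, l, h22, h⟩
  · exfalso
    have hd : deriv f31 0 = lam * deriv f11 0 := by
      rw [funext h31, deriv_const_mul _ (hd11 0)]
    have h := hH 0
    rw [h31, hd] at h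
    have h' : (lam ^ 2 - 1) * f11 0 * deriv f11 0 = 0 := by linear_combination -h
    have hd0 := (mul_eq_zero.mp h').resolve_left (mul_ne_zero (sub_ne_zero.mpr hlam) (h11 0))
    exact hnondeg 0 (by rw [hd, hd0]; ring)
  · exfalso
    have hd (x : ℝ) : deriv f11 x = 0 := by rw [funext h0]; simp
    have h31 (x : ℝ) : f31 x = 0 := by
      have h := hH x
      rw [h0, zero_mul] at h
      refine (mul_eq_zero.mp h.symm).resolve_right fun h' => hnondeg x ?_
      rw [hd, h']; ring
    exact hnondeg 0 (by rw [hd, funext h31]; simp)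
  · exfalso
    have hd (x : ℝ) : deriv f31 x = 0 := by rw [funext h0]; simp
    have h11 (x : ℝ) : f11 x = 0 := by
      have h := hH x
      rw [h0, zero_mul] at h
      refine (mul_eq_zero.mp h).resolve_right fun h' => hnondeg x ?_
      rw [hd, h']; ring
    exact hnondeg 0 (by rw [hd, funext h11]; simp)
  · exfalso
    obtain ⟨p, hp⟩ := hUne
    have hb0 := eq_zero_of_hyperbola_relation hd11 hd31 hhyp hH hL
      (A := -fderiv ℝ a p (1, 0)) (B := -2 * b p) (D := (a p - c p) * η)
      fun x => by linear_combination (htop p hp x).1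
    have hac := eq_zero_of_hyperbola_relation hd11 hd31 hhyp hH hL
      (A := -fderiv ℝ b p (1, 0)) (B := a p - c p) (D := 2 * b p * η)
      fun x => by linear_combination (htop p hp x).2
    have hb0' : b p = 0 := by linarith
    have hac' : c p = a p := by linarith
    have hG := hGauss p hp
    rw [hb0', hac'] at hG
    nlinarith [sq_nonneg (a p)]
  · exact absurd (sub_eq_zero.mpr (hH 0)) (hH' 0)
end

section
/- Suppose ε ∈ {1,−1}, f31 = ε·f11, f32 = ε·f12, f22 is identically equal to a constant β, f11′ is nowhere zero, and ∂f12/∂z_{k−1} is nowhere zero. If smooth functions a, b, c on a nonempty open connected set U ⊆ ℝ² satisfy the Codazzi identities (C1), (C2) and the Gauss equation a·c − b² = −1, then there exist constants γ, l ∈ ℝ such that, writing s = ε·(η·x + β·t), for all (x,t) ∈ U: b(x,t) = γ·e^{2s}, a is nowhere zero on U with a(x,t)² = l·e^{2s} − γ²·e^{4s} − 1, and c(x,t) = (γ²·e^{4s} − 1)/a(x,t). -/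
open Real Finset

/-- If the derivative of `f` along the `i`-th coordinate at `0` is nonzero for some `i ≠ 0`, then
`f` takes two distinct values at points with the same zeroth coordinate. -/
lemma exists_ne_of_pd_ne_zero {n i : ℕ} (hi : i ≠ 0) {f : (Fin (n + 1) → ℝ) → ℝ}
    (hf : Differentiable ℝ f) (h : pd f 0 i ≠ 0) :
    ∃ z : Fin (n + 1) → ℝ, z 0 = 0 ∧ f z ≠ f 0 := by
  by_contra! hcon
  apply h
  set e : Fin (n + 1) → ℝ := fun j => if (j : ℕ) = i then 1 else 0 with he
  have hline : HasLineDerivAt ℝ f (fderiv ℝ f 0 e) 0 e :=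
    (hf 0).hasFDerivAt.hasLineDerivAt e
  have hconst : (fun t : ℝ => f (0 + t • e)) = fun _ => f 0 := by
    funext t
    apply hcon
    simp [he, hi.symm]
  unfold HasLineDerivAt at hline
  rw [hconst] at hline
  exact hline.unique (hasDerivAt_const _ _)

/-- A function with nonvanishing derivative at `0` takes two distinct values. -/
lemma exists_ne_of_deriv_ne_zero {f : ℝ → ℝ} (h : deriv f 0 ≠ 0) : ∃ r, f r ≠ f 0 := by
  by_contra! hcon
  apply h
  rw [show f = fun _ => f 0 from funext hcon, deriv_const]

/-- The linear form `(x, t) ↦ u x + v t`. -/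
noncomputable def planeForm (u v : ℝ) : ℝ × ℝ →L[ℝ] ℝ :=
  u • ContinuousLinearMap.fst ℝ ℝ ℝ + v • ContinuousLinearMap.snd ℝ ℝ ℝ

lemma planeForm_apply (u v : ℝ) (p : ℝ × ℝ) : planeForm u v p = u * p.1 + v * p.2 := by
  simp [planeForm]

lemma eq_smul_planeForm {φ : ℝ × ℝ →L[ℝ] ℝ} {r u v : ℝ} (h1 : φ (1, 0) = r * u)
    (h2 : φ (0, 1) = r * v) : φ = r • planeForm u v := by
  ext <;> simp [planeForm, h1, h2]

/-- If `f11 A - f12 B + C` vanishes identically, where `f11` is nonconstant and `f12` is nonconstant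
on the hyperplane `z 0 = 0`, then `A = B = 0`. -/
lemma coeffs_eq_zero {k : ℕ} {f11 : ℝ → ℝ} {f12 : (Fin (k + 1) → ℝ) → ℝ}
    (h11 : ∃ r, f11 r ≠ f11 0) (h12 : ∃ z : Fin (k + 1) → ℝ, z 0 = 0 ∧ f12 z ≠ f12 0)
    {A B C : ℝ} (h : ∀ z : Fin (k + 1) → ℝ, f11 (z 0) * A - f12 z * B + C = 0) :
    A = 0 ∧ B = 0 := by
  obtain ⟨z, hz0, hz⟩ := h12
  obtain ⟨r, hr⟩ := h11
  have h0 := h 0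
  have h1 := h z
  rw [hz0] at h1
  simp only [Pi.zero_apply] at h0
  have hB : B = 0 := by
    have : (f12 z - f12 0) * B = 0 := by linear_combination h0 - h1
    exact (mul_eq_zero.mp this).resolve_left (sub_ne_zero.mpr hz)
  refine ⟨?_, hB⟩
  have h2 := h (fun _ => r)
  simp only [hB] at h0 h2
  have : (f11 r - f11 0) * A = 0 := by linear_combination h2 - h0
  exact (mul_eq_zero.mp this).resolve_left (sub_ne_zero.mpr hr)

/-- Solutions of `da = (a - c) dL`, `db = 2 b dL`, `a c - b² = -1` for a nonzero linear
form `L`. -/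
lemma exists_formula_of_hasFDerivAt {U : Set (ℝ × ℝ)} (hUopen : IsOpen U)
    (hUconn : IsPreconnected U) {a b c : ℝ × ℝ → ℝ} {L : ℝ × ℝ →L[ℝ] ℝ} (hL : L ≠ 0)
    (ha : ∀ p ∈ U, HasFDerivAt a ((a p - c p) • L) p)
    (hb : ∀ p ∈ U, HasFDerivAt b ((2 * b p) • L) p)
    (hc : ∀ p ∈ U, DifferentiableAt ℝ c p)
    (hGauss : ∀ p ∈ U, a p * c p - b p ^ 2 = -1) :
    ∃ γ l : ℝ, ∀ p ∈ U,
      b p = γ * Real.exp (2 * L p) ∧ a p ≠ 0 ∧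
      a p ^ 2 = l * Real.exp (2 * L p) - γ ^ 2 * Real.exp (4 * L p) - 1 ∧
      c p = (γ ^ 2 * Real.exp (4 * L p) - 1) / a p := by
  have hexp : ∀ (m : ℝ) (p : ℝ × ℝ),
      HasFDerivAt (fun q => Real.exp (m * L q)) (Real.exp (m * L p) • m • L) p :=
    fun m p => (L.hasFDerivAt.const_mul m).exp
  have hinv : ∀ p, Real.exp (-2 * L p) * Real.exp (2 * L p) = 1 := fun p => by
    rw [← Real.exp_add]; simp
  have hsq : ∀ p, Real.exp (4 * L p) = Real.exp (2 * L p) ^ 2 := fun p => by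
    rw [← Real.exp_nat_mul]; push_cast; ring_nf
  obtain ⟨γ, hγ⟩ : ∃ γ, ∀ p ∈ U, b p * Real.exp (-2 * L p) = γ := by
    have hd : ∀ p ∈ U, HasFDerivAt (fun q => b q * Real.exp (-2 * L q)) 0 p := fun p hp => by
      refine ((hb p hp).mul (hexp (-2) p)).congr_fderiv ?_
      ext <;> simp <;> ring
    exact hUopen.exists_is_const_of_fderiv_eq_zero hUconn
      (fun p hp => (hd p hp).differentiableAt.differentiableWithinAt) fun p hp => (hd p hp).fderiv
  have hbγ : ∀ p ∈ U, b p = γ * Real.exp (2 * L p) := fun p hp => by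
    linear_combination Real.exp (2 * L p) * hγ p hp - b p * hinv p
  obtain ⟨l, hl⟩ : ∃ l, ∀ p ∈ U, (a p * a p + b p * b p + 1) * Real.exp (-2 * L p) = l := by
    have hd : ∀ p ∈ U, HasFDerivAt
        (fun q => (a q * a q + b q * b q + 1) * Real.exp (-2 * L q)) 0 p := fun p hp => by
      refine (((((ha p hp).mul (ha p hp)).add ((hb p hp).mul (hb p hp))).add_const 1).mul
        (hexp (-2) p)).congr_fderiv ?_
      ext <;> simp
      · linear_combination (-2 * Real.exp (-(2 * L p)) * L (1, 0)) * hGauss p hp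
      · linear_combination (-2 * Real.exp (-(2 * L p)) * L (0, 1)) * hGauss p hp
    exact hUopen.exists_is_const_of_fderiv_eq_zero hUconn
      (fun p hp => (hd p hp).differentiableAt.differentiableWithinAt) fun p hp => (hd p hp).fderiv
  have hane : ∀ p ∈ U, a p ≠ 0 := fun p hp h0 => by
    have hd := ((ha p hp).mul (hc p hp).hasFDerivAt).sub ((hb p hp).mul (hb p hp))
    have hconst : (fun q => a q * c q - b q * b q) =ᶠ[nhds p] fun _ => -1 := by
      filter_upwards [hUopen.mem_nhds hp] with q hq
      linear_combination hGauss q hq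
    have hzero := hd.unique ((hasFDerivAt_const (-1 : ℝ) p).congr_of_eventuallyEq hconst)
    obtain ⟨v, hv⟩ : ∃ v, L v ≠ 0 := by
      by_contra! hcon
      exact hL (ContinuousLinearMap.ext hcon)
    have hzv := congrArg (fun φ : ℝ × ℝ →L[ℝ] ℝ => φ v) hzero
    simp [h0] at hzv
    have hG := hGauss p hp
    rw [h0] at hG
    have hprod : (c p ^ 2 + 4 * b p ^ 2) * L v = 0 := by linear_combination -hzv
    have := (mul_eq_zero.mp hprod).resolve_right hv
    nlinarith [sq_nonneg (c p)]
  refine ⟨γ, l, fun p hp => ⟨hbγ p hp, hane p hp, ?_, ?_⟩⟩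
  · rw [hsq]
    linear_combination Real.exp (2 * L p) * hl p hp - (a p ^ 2 + b p ^ 2 + 1) * hinv p
      - (b p + γ * Real.exp (2 * L p)) * hbγ p hp
  · rw [eq_div_iff (hane p hp), hsq]
    linear_combination hGauss p hp + (b p + γ * Real.exp (2 * L p)) * hbγ p hp

/-- Proposition 1 of the paper.  In branch I (`f31 = ε·f11`,
`f32 = ε·f12`, `f22 ≡ β`, `f11' ≠ 0`, `∂f12/∂z_{k-1} ≠ 0`), any smooth solution
`a, b, c` of the Codazzi and Gauss equations on a nonempty open connected `U` is given by
the universal formulas in `s = ε·(η·x + β·t)`. -/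
theorem stmt1 (k : ℕ) (hk : 2 ≤ k) (η : ℝ) (hη : η ≠ 0)
    (f11 f31 : ℝ → ℝ) (f12 f22 f32 : (Fin (k+1) → ℝ) → ℝ)
    (hf11 : ContDiff ℝ (⊤ : ℕ∞) f11) (hf31 : ContDiff ℝ (⊤ : ℕ∞) f31)
    (hf12 : ContDiff ℝ (⊤ : ℕ∞) f12) (hf22 : ContDiff ℝ (⊤ : ℕ∞) f22)
    (hf32 : ContDiff ℝ (⊤ : ℕ∞) f32)
    (hdep12 : DependsOnFirst k f12) (hdep32 : DependsOnFirst k f32)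
    (hdep22 : DependsOnFirst (k-1) f22)
    (ε : ℝ) (hε : ε = 1 ∨ ε = -1)
    (hI31 : ∀ z0 : ℝ, f31 z0 = ε * f11 z0)
    (hI32 : ∀ z : Fin (k+1) → ℝ, f32 z = ε * f12 z)
    (β : ℝ) (hI22 : ∀ z : Fin (k+1) → ℝ, f22 z = β)
    (hf11' : ∀ z0 : ℝ, deriv f11 z0 ≠ 0)
    (hf12' : ∀ z : Fin (k+1) → ℝ, pd f12 z (k-1) ≠ 0)
    (U : Set (ℝ × ℝ)) (hUopen : IsOpen U) (hUne : U.Nonempty) (hUconn : IsConnected U)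
    (a b c : ℝ × ℝ → ℝ)
    (ha : ContDiffOn ℝ (⊤ : ℕ∞) a U) (hb : ContDiffOn ℝ (⊤ : ℕ∞) b U)
    (hc : ContDiffOn ℝ (⊤ : ℕ∞) c U)
    (hCod : Codazzi k η f11 f31 f12 f22 f32 U a b c)
    (hGauss : ∀ p ∈ U, a p * c p - (b p) ^ 2 = -1) :
    ∃ γ l : ℝ, ∀ p ∈ U,
      b p = γ * Real.exp (2 * (ε * (η * p.1 + β * p.2))) ∧
      a p ≠ 0 ∧
      (a p) ^ 2 = l * Real.exp (2 * (ε * (η * p.1 + β * p.2)))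
        - γ ^ 2 * Real.exp (4 * (ε * (η * p.1 + β * p.2))) - 1 ∧
      c p = (γ ^ 2 * Real.exp (4 * (ε * (η * p.1 + β * p.2))) - 1) / a p := by
  have hdiff : ∀ {g : ℝ × ℝ → ℝ}, ContDiffOn ℝ (⊤ : ℕ∞) g U → ∀ p ∈ U, DifferentiableAt ℝ g p :=
    fun hg p hp => (hg.differentiableOn (by simp)).differentiableAt (hUopen.mem_nhds hp)
  have h11 := exists_ne_of_deriv_ne_zero (hf11' 0)
  have h12 := exists_ne_of_pd_ne_zero (by omega) (hf12.differentiable (by simp)) (hf12' 0)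
  have hL : planeForm (ε * η) (ε * β) ≠ 0 := fun h => by
    have := congrArg (fun φ : ℝ × ℝ →L[ℝ] ℝ => φ (1, 0)) h
    rcases hε with rfl | rfl <;> simp [planeForm_apply, hη] at this
  have ha' : ∀ p ∈ U, HasFDerivAt a ((a p - c p) • planeForm (ε * η) (ε * β)) p := fun p hp => by
    obtain ⟨hA, hB⟩ := coeffs_eq_zero h11 h12
      (A := fderiv ℝ a p (0, 1) - (a p - c p) * (ε * β))
      (B := fderiv ℝ a p (1, 0) - (a p - c p) * (ε * η))
      (C := η * fderiv ℝ b p (0, 1) - β * fderiv ℝ b p (1, 0)) fun z => by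
        have h := (hCod p hp z).1
        rw [hI31, hI32, hI22] at h
        linear_combination h
    exact (hdiff ha p hp).hasFDerivAt.congr_fderiv
      (eq_smul_planeForm (sub_eq_zero.mp hB) (sub_eq_zero.mp hA))
  have hb' : ∀ p ∈ U, HasFDerivAt b ((2 * b p) • planeForm (ε * η) (ε * β)) p := fun p hp => by
    obtain ⟨hA, hB⟩ := coeffs_eq_zero h11 h12
      (A := fderiv ℝ b p (0, 1) - 2 * b p * (ε * β))
      (B := fderiv ℝ b p (1, 0) - 2 * b p * (ε * η))
      (C := η * fderiv ℝ c p (0, 1) - β * fderiv ℝ c p (1, 0)) fun z => by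
        have h := (hCod p hp z).2
        rw [hI31, hI32, hI22] at h
        linear_combination h
    exact (hdiff hb p hp).hasFDerivAt.congr_fderiv
      (eq_smul_planeForm (sub_eq_zero.mp hB) (sub_eq_zero.mp hA))
  have hform : ∀ p : ℝ × ℝ, planeForm (ε * η) (ε * β) p = ε * (η * p.1 + β * p.2) := fun p => by
    rw [planeForm_apply]; ring
  simpa only [hform] using exists_formula_of_hasFDerivAt hUopen hUconn.isPreconnected hL ha' hb'
    (hdiff hc) hGauss
end

section
/- Let η ≠ 0, β ∈ ℝ, ε ∈ {1,−1}, and γ, l ∈ ℝ. On the open set W = {(x,t) ∈ ℝ² : l·e^{2ε(ηx+βt)} − γ²·e^{4ε(ηx+βt)} − 1 > 0}, define b = γ·e^{2ε(ηx+βt)}, a = √(l·e^{2ε(ηx+βt)} − γ²·e^{4ε(ηx+βt)} − 1), and c = (b² − 1)/a. Then a, b, c are smooth on W, satisfy a·c − b² = −1, and for every integer k ≥ 2 and all smooth functions f11 : ℝ → ℝ and f12 : ℝ^k → ℝ, the identities f11·∂a/∂t + η·∂b/∂t − f12·∂a/∂x − β·∂b/∂x − ε·(a − c)·(β·f11 −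 η·f12) = 0 and f11·∂b/∂t + η·∂c/∂t − f12·∂b/∂x − β·∂c/∂x − 2ε·b·(β·f11 − η·f12) = 0 hold at every (x,t) ∈ W, for every value z0 ∈ ℝ of the argument of f11 and every value (z0,…,z_{k−1}) ∈ ℝ^k of the argument of f12. -/
open Real

/-- `s = ε·(η·x + β·t)`. -/
noncomputable def sI (η β ε : ℝ) (p : ℝ × ℝ) : ℝ := ε * (η * p.1 + β * p.2)

/-- Second fundamental form coefficient `a = √(l·e^{2s} − γ²·e^{4s} − 1)`. -/
noncomputable def aI (η β ε γ l : ℝ) (p : ℝ × ℝ) : ℝ :=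
  Real.sqrt (l * Real.exp (2 * sI η β ε p) - γ ^ 2 * Real.exp (4 * sI η β ε p) - 1)

/-- Second fundamental form coefficient `b = γ·e^{2s}`. -/
noncomputable def bI (η β ε γ : ℝ) (p : ℝ × ℝ) : ℝ := γ * Real.exp (2 * sI η β ε p)

/-- Second fundamental form coefficient `c = (b² − 1)/a`. -/
noncomputable def cI (η β ε γ l : ℝ) (p : ℝ × ℝ) : ℝ :=
  ((bI η β ε γ p) ^ 2 - 1) / aI η β ε γ l p

/-- The strip `W = {(x,t) : l·e^{2s} − γ²·e^{4s} − 1 > 0}`. -/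
def WI (η β ε γ l : ℝ) : Set (ℝ × ℝ) :=
  {p | 0 < l * Real.exp (2 * sI η β ε p) - γ ^ 2 * Real.exp (4 * sI η β ε p) - 1}

theorem contDiff_sI (η β ε : ℝ) {n : WithTop ℕ∞} : ContDiff ℝ n (sI η β ε) := by
  unfold sI
  fun_prop

theorem contDiffOn_aI (η β ε γ l : ℝ) {n : WithTop ℕ∞} :
    ContDiffOn ℝ n (aI η β ε γ l) (WI η β ε γ l) := by
  have hs := contDiff_sI η β ε (n := n)
  unfold aI
  refine ContDiffOn.sqrt (ContDiff.contDiffOn (by fun_prop)) fun p hp => ?_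
  exact ne_of_gt hp

theorem contDiff_bI (η β ε γ : ℝ) {n : WithTop ℕ∞} : ContDiff ℝ n (bI η β ε γ) := by
  have hs := contDiff_sI η β ε (n := n)
  unfold bI
  fun_prop

theorem aI_pos {η β ε γ l : ℝ} {p : ℝ × ℝ} (hp : p ∈ WI η β ε γ l) : 0 < aI η β ε γ l p :=
  Real.sqrt_pos.2 hp

theorem contDiffOn_cI (η β ε γ l : ℝ) {n : WithTop ℕ∞} :
    ContDiffOn ℝ n (cI η β ε γ l) (WI η β ε γ l) := by
  unfold cI
  exact (((contDiff_bI η β ε γ).pow 2).sub contDiff_const).contDiffOn.div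
    (contDiffOn_aI η β ε γ l) fun p hp => (aI_pos hp).ne'

theorem hasFDerivAt_sI (η β ε : ℝ) (p : ℝ × ℝ) :
    HasFDerivAt (sI η β ε)
      (ε • (η • ContinuousLinearMap.fst ℝ ℝ ℝ + β • ContinuousLinearMap.snd ℝ ℝ ℝ)) p := by
  exact ((hasFDerivAt_fst.const_mul η).add (hasFDerivAt_snd.const_mul β)).const_mul ε

/-- The chain rule for a function of `sI` alone. -/
theorem fderiv_comp_sI {η β ε : ℝ} {p : ℝ × ℝ} {G : ℝ → ℝ} {G' : ℝ}
    (hG : HasDerivAt G G' (sI η β ε p)) (v : ℝ × ℝ) :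
    fderiv ℝ (fun q => G (sI η β ε q)) p v = G' * (ε * (η * v.1 + β * v.2)) := by
  have h := hG.comp_hasFDerivAt p (hasFDerivAt_sI η β ε p)
  have h' := h.fderiv
  simp only [Function.comp_def] at h'
  rw [h']
  simp [mul_add]

theorem hasDerivAt_exp_const_mul (k s : ℝ) :
    HasDerivAt (fun s => Real.exp (k * s)) (k * Real.exp (k * s)) s := by
  simpa [mul_comm] using ((hasDerivAt_id s).const_mul k).exp

theorem bI_sq (η β ε γ : ℝ) (p : ℝ × ℝ) :
    bI η β ε γ p ^ 2 = γ ^ 2 * Real.exp (4 * sI η β ε p) := by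
  rw [bI, mul_pow, ← Real.exp_nat_mul]
  congr 2
  push_cast
  ring

theorem fderiv_bI (η β ε γ : ℝ) (p v : ℝ × ℝ) :
    fderiv ℝ (bI η β ε γ) p v = 2 * bI η β ε γ p * (ε * (η * v.1 + β * v.2)) := by
  have h := fderiv_comp_sI ((hasDerivAt_exp_const_mul 2 (sI η β ε p)).const_mul γ) v
  refine h.trans ?_
  rw [bI]
  ring

theorem fderiv_aI {η β ε γ l : ℝ} {p : ℝ × ℝ} (hp : p ∈ WI η β ε γ l) (v : ℝ × ℝ) :
    fderiv ℝ (aI η β ε γ l) p v =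
      (aI η β ε γ l p - cI η β ε γ l p) * (ε * (η * v.1 + β * v.2)) := by
  have hR := (((hasDerivAt_exp_const_mul 2 (sI η β ε p)).const_mul l).sub
    ((hasDerivAt_exp_const_mul 4 (sI η β ε p)).const_mul (γ ^ 2))).sub_const 1
  refine (fderiv_comp_sI (hR.sqrt (ne_of_gt hp)) v).trans ?_
  congr 1
  have ha : 0 < aI η β ε γ l p := aI_pos hp
  have hsq : aI η β ε γ l p ^ 2 =
      l * Real.exp (2 * sI η β ε p) - γ ^ 2 * Real.exp (4 * sI η β ε p) - 1 :=
    Real.sq_sqrt (le_of_lt hp)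
  change _ / (2 * aI η β ε γ l p) = _
  rw [cI, bI_sq]
  field_simp
  rw [hsq]
  ring_nf

theorem exists_fderiv_cI {η β ε γ l : ℝ} {p : ℝ × ℝ} (hp : p ∈ WI η β ε γ l) :
    ∃ d : ℝ, ∀ v : ℝ × ℝ, fderiv ℝ (cI η β ε γ l) p v = d * (ε * (η * v.1 + β * v.2)) := by
  have hR := (((hasDerivAt_exp_const_mul 2 (sI η β ε p)).const_mul l).sub
    ((hasDerivAt_exp_const_mul 4 (sI η β ε p)).const_mul (γ ^ 2))).sub_const 1
  have hb := (hasDerivAt_exp_const_mul 2 (sI η β ε p)).const_mul γ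
  exact ⟨_, fderiv_comp_sI (((hb.pow 2).sub_const 1).div (hR.sqrt (ne_of_gt hp)) (aI_pos hp).ne')⟩

/-- The universal functions `a, b, c` are smooth on `W`, satisfy the
Gauss equation `a·c − b² = −1`, and satisfy the branch-I Codazzi equations for every
`k ≥ 2`, all smooth `f11 : ℝ → ℝ`, `f12 : ℝ^k → ℝ`, and all values of their arguments.
Here `(1,0)` is the `∂/∂x` direction and `(0,1)` the `∂/∂t` direction. -/
theorem stmt2 (η β ε γ l : ℝ) (hη : η ≠ 0) (hε : ε = 1 ∨ ε = -1) :
    ContDiffOn ℝ (⊤ : ℕ∞) (aI η β ε γ l) (WI η β ε γ l) ∧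
    ContDiffOn ℝ (⊤ : ℕ∞) (bI η β ε γ) (WI η β ε γ l) ∧
    ContDiffOn ℝ (⊤ : ℕ∞) (cI η β ε γ l) (WI η β ε γ l) ∧
    (∀ p ∈ WI η β ε γ l,
      aI η β ε γ l p * cI η β ε γ l p - (bI η β ε γ p) ^ 2 = -1) ∧
    (∀ k : ℕ, 2 ≤ k → ∀ f11 : ℝ → ℝ, ContDiff ℝ (⊤ : ℕ∞) f11 →
      ∀ f12 : (Fin k → ℝ) → ℝ, ContDiff ℝ (⊤ : ℕ∞) f12 →
      ∀ z0 : ℝ, ∀ zv : Fin k → ℝ, ∀ p ∈ WI η β ε γ l,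
        f11 z0 * fderiv ℝ (aI η β ε γ l) p (0, 1) + η * fderiv ℝ (bI η β ε γ) p (0, 1)
          - f12 zv * fderiv ℝ (aI η β ε γ l) p (1, 0) - β * fderiv ℝ (bI η β ε γ) p (1, 0)
          - ε * (aI η β ε γ l p - cI η β ε γ l p) * (β * f11 z0 - η * f12 zv) = 0 ∧
        f11 z0 * fderiv ℝ (bI η β ε γ) p (0, 1) + η * fderiv ℝ (cI η β ε γ l) p (0, 1)
          - f12 zv * fderiv ℝ (bI η β ε γ) p (1, 0) - β * fderiv ℝ (cI η β ε γ l) p (1, 0)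
          - 2 * ε * bI η β ε γ p * (β * f11 z0 - η * f12 zv) = 0) := by
  refine ⟨contDiffOn_aI η β ε γ l, (contDiff_bI η β ε γ).contDiffOn, contDiffOn_cI η β ε γ l,
    fun p hp => ?_, fun k _ f11 _ f12 _ z0 zv p hp => ?_⟩
  · have ha := (aI_pos hp).ne'
    rw [cI, mul_div_cancel₀ _ ha]
    ring
  · obtain ⟨d, hd⟩ := exists_fderiv_cI hp
    simp only [fderiv_aI hp, fderiv_bI, hd]
    constructor
    · ring
    · ring
end

section
/- Suppose f31² − f11² is identically equal to a nonzero constant C, the function L := f11·f31′ − f31·f11′ is nowhere zero, and f11 and f31 are nowhere zero. Assume the structure equations (S1)–(S3) hold and ∂F/∂z_k is nowhere zero. Then there exist no smooth functions a, b, c on any nonempty open set U ⊆ ℝ² satisfying the Codazzi identities (C1), (C2) and the Gauss equation a·c − b² = −1. -/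
open Real Finset

theorem hasDerivAt_comp_line {n : ℕ} {f : (Fin n → ℝ) → ℝ} (hf : Differentiable ℝ f)
    (z : Fin n → ℝ) (i : ℕ) :
    HasDerivAt (fun s : ℝ => f (z + s • fun j : Fin n => if (j : ℕ) = i then (1 : ℝ) else 0))
      (pd f z i) 0 := by
  set e : Fin n → ℝ := fun j => if (j : ℕ) = i then (1 : ℝ) else 0 with he
  have hline : HasDerivAt (fun s : ℝ => z + s • e) e 0 := by
    simpa using ((hasDerivAt_id (0 : ℝ)).smul_const e).const_add z
  have hfz : HasFDerivAt f (fderiv ℝ f z) (z + (0 : ℝ) • e) := by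
    simpa using (hf z).hasFDerivAt
  exact hfz.comp_hasDerivAt (0 : ℝ) hline

theorem DependsOnFirst.line {n m i : ℕ} {f : (Fin n → ℝ) → ℝ} (hf : DependsOnFirst m f)
    (hmi : m ≤ i) (z : Fin n → ℝ) (s : ℝ) :
    f (z + s • fun j : Fin n => if (j : ℕ) = i then (1 : ℝ) else 0) = f z := by
  refine hf _ _ fun j hj => ?_
  have : (j : ℕ) ≠ i := by omega
  simp [this]

theorem DependsOnFirst.pd_line {n m i : ℕ} {f : (Fin n → ℝ) → ℝ} (hf : DependsOnFirst m f)
    (hmi : m ≤ i) (z : Fin n → ℝ) (s : ℝ) (l : ℕ) :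
    pd f (z + s • fun j : Fin n => if (j : ℕ) = i then (1 : ℝ) else 0) l = pd f z l := by
  have h : (fun y => f (y + s • fun j : Fin n => if (j : ℕ) = i then (1 : ℝ) else 0)) = f :=
    funext fun y => hf.line hmi y s
  unfold pd
  rw [← fderiv_comp_add_right, h]

/-- Comparing the coefficients of the highest-order coordinate `z_k` in an identity
`A F = D f + G`, where `D` is the total derivative and `A`, `f`, `G` do not involve `z_k`. -/
theorem mul_pd_eq_pd_of_total_derivative {m : ℕ} {A f G F : (Fin (m + 1 + 1) → ℝ) → ℝ}
    (hA : DependsOnFirst (m + 1) A) (hf : DependsOnFirst (m + 1) f)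
    (hG : DependsOnFirst (m + 1) G) (hF : Differentiable ℝ F)
    (h : ∀ z, A z * F z = (∑ i ∈ Finset.range (m + 1), pd f z i * zc z (i + 1)) + G z)
    (z : Fin (m + 1 + 1) → ℝ) : A z * pd F z (m + 1) = pd f z m := by
  have hl := (hasDerivAt_comp_line hF z (m + 1)).const_mul (A z)
  have hr : HasDerivAt (fun s : ℝ => A z * F z + pd f z m * s) (pd f z m) 0 := by
    simpa using ((hasDerivAt_id (0 : ℝ)).const_mul (pd f z m)).const_add (A z * F z)
  refine hl.unique (hr.congr_of_eventuallyEq (Filter.Eventually.of_forall fun s => ?_))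
  have hs := h (z + s • fun j : Fin (m + 1 + 1) => if (j : ℕ) = m + 1 then (1 : ℝ) else 0)
  have hz := h z
  simp only [hA.line le_rfl, hG.line le_rfl, hf.pd_line le_rfl, Finset.sum_range_succ] at hs hz
  have hlow : ∀ i ∈ Finset.range m,
      pd f z i * zc (z + s • fun j : Fin (m + 1 + 1) => if (j : ℕ) = m + 1 then (1 : ℝ) else 0)
        (i + 1) = pd f z i * zc z (i + 1) := by
    intro i hi
    have hi' : i < m := Finset.mem_range.mp hi
    simp [zc, hi'.ne]
  have htop : zc (z + s • fun j : Fin (m + 1 + 1) => if (j : ℕ) = m + 1 then (1 : ℝ) else 0)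
      (m + 1) = zc z (m + 1) + s := by
    simp [zc]
  rw [Finset.sum_congr rfl hlow, htop] at hs
  simp only
  linarith

/-- A linear relation between the derivatives and the Wronskian of two functions lying on a
hyperbola `g² - f² = C` has vanishing coefficients. -/
theorem coeff_eq_zero_of_hyperbola {f g : ℝ → ℝ} {C p q r : ℝ}
    (hf : Differentiable ℝ f) (hg : Differentiable ℝ g) (hC : C ≠ 0)
    (hfg : ∀ x, g x ^ 2 - f x ^ 2 = C)
    (hW : ∀ x, f x * deriv g x - g x * deriv f x ≠ 0)
    (h : ∀ x, p * deriv f x + q * deriv g x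
      + r * (f x * deriv g x - g x * deriv f x) = 0) :
    q = 0 ∧ r = 0 := by
  have hd : ∀ x, g x * deriv g x = f x * deriv f x := by
    intro x
    have h1 := ((hg x).hasDerivAt.pow 2).sub ((hf x).hasDerivAt.pow 2)
    have h2 : HasDerivAt (g ^ 2 - f ^ 2) 0 x := by
      rw [show g ^ 2 - f ^ 2 = fun _ => C from funext hfg]
      exact hasDerivAt_const x C
    have := h1.unique h2
    norm_num at this
    linarith
  have hf' : ∀ x, C * deriv f x = -g x * (f x * deriv g x - g x * deriv f x) := by
    intro x
    linear_combination (-deriv f x) * hfg x + f x * hd x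
  have hg' : ∀ x, C * deriv g x = -f x * (f x * deriv g x - g x * deriv f x) := by
    intro x
    linear_combination (-deriv g x) * hfg x + g x * hd x
  have hlin : ∀ x, p * g x + q * f x = r * C := by
    intro x
    apply mul_right_cancel₀ (hW x)
    linear_combination (-C) * h x + p * hf' x + q * hg' x
  have hlin' : ∀ x, p * deriv g x + q * deriv f x = 0 := by
    intro x
    have h1 := ((hg x).hasDerivAt.const_mul p).add ((hf x).hasDerivAt.const_mul q)
    refine h1.unique ((hasDerivAt_const x (r * C)).congr_of_eventuallyEq ?_)
    exact Filter.Eventually.of_forall hlin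
  have hdual : ∀ x, p * f x + q * g x = 0 := by
    intro x
    apply mul_right_cancel₀ (hW x)
    linear_combination (-C) * hlin' x + p * hg' x + q * hf' x
  have hq : ∀ x, q = -(r * f x) := by
    intro x
    apply mul_right_cancel₀ hC
    linear_combination (-q) * hfg x + g x * hdual x - f x * hlin x
  have hr : r = 0 := by
    by_contra hr
    have hconst : f = fun _ => f 0 := by
      funext x
      exact mul_left_cancel₀ hr (by linarith [hq x, hq 0])
    have hf0 : ∀ x, deriv f x = 0 := by
      intro x
      rw [hconst]
      exact deriv_const x _
    have hg0 : g = fun _ => 0 := by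
      funext x
      have h1 := hf' x
      rw [hf0, mul_zero] at h1
      exact neg_eq_zero.mp ((mul_eq_zero.mp h1.symm).resolve_right (by simpa [hf0] using hW x))
    exact hW 0 (by simp [hg0])
  exact ⟨by rw [hq 0, hr]; ring, hr⟩

/-- Proposition 4 of the paper.  In branch IV (`f31² − f11² ≡ C ≠ 0`,
`L = f11·f31' − f31·f11'` nowhere zero, `f11`, `f31` nowhere zero), under the
structure equations with `∂F/∂z_k` nowhere zero, no smooth `a, b, c` on a nonempty
open set satisfy the Codazzi identities and the Gauss equation. -/
theorem stmt7 (k : ℕ) (hk : 2 ≤ k) (η : ℝ) (hη : η ≠ 0)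
    (f11 f31 : ℝ → ℝ) (f12 f22 f32 F : (Fin (k+1) → ℝ) → ℝ)
    (hf11 : ContDiff ℝ (⊤ : ℕ∞) f11) (hf31 : ContDiff ℝ (⊤ : ℕ∞) f31)
    (hf12 : ContDiff ℝ (⊤ : ℕ∞) f12) (hf22 : ContDiff ℝ (⊤ : ℕ∞) f22)
    (hf32 : ContDiff ℝ (⊤ : ℕ∞) f32) (hF : ContDiff ℝ (⊤ : ℕ∞) F)
    (hdep12 : DependsOnFirst k f12) (hdep32 : DependsOnFirst k f32)
    (hdep22 : DependsOnFirst (k-1) f22)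
    (C : ℝ) (hC : C ≠ 0) (hC31 : ∀ z0 : ℝ, (f31 z0) ^ 2 - (f11 z0) ^ 2 = C)
    (hL : ∀ z0 : ℝ, f11 z0 * deriv f31 z0 - f31 z0 * deriv f11 z0 ≠ 0)
    (h11 : ∀ z0 : ℝ, f11 z0 ≠ 0) (h31 : ∀ z0 : ℝ, f31 z0 ≠ 0)
    (hS : StructEqs k η f11 f31 f12 f22 f32 F)
    (hFk : ∀ z : Fin (k+1) → ℝ, pd F z k ≠ 0) :
    ¬ ∃ (U : Set (ℝ × ℝ)) (a b c : ℝ × ℝ → ℝ),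
      U.Nonempty ∧ IsOpen U ∧
      ContDiffOn ℝ (⊤ : ℕ∞) a U ∧ ContDiffOn ℝ (⊤ : ℕ∞) b U ∧
      ContDiffOn ℝ (⊤ : ℕ∞) c U ∧
      Codazzi k η f11 f31 f12 f22 f32 U a b c ∧
      (∀ p ∈ U, a p * c p - (b p) ^ 2 = -1) := by
  rintro ⟨U, a, b, c, ⟨p, hp⟩, -, -, -, -, hcod, hgauss⟩
  obtain ⟨m, rfl⟩ : ∃ m, k = m + 1 := ⟨k - 1, by omega⟩
  have hm : 1 ≤ m := by omega
  rw [Nat.add_sub_cancel] at hdep22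
  have hz0 : ∀ g : ℝ → ℝ, DependsOnFirst m fun z : Fin (m + 1 + 1) → ℝ => g (z 0) :=
    fun g z w hzw => congrArg g (hzw 0 hm)
  have mono : ∀ {f : (Fin (m + 1 + 1) → ℝ) → ℝ}, DependsOnFirst m f →
      DependsOnFirst (m + 1) f := fun hf z w hzw => hf z w fun j hj => hzw j (by omega)
  have hFd : Differentiable ℝ F := hF.differentiable (by simp)
  have top12 : ∀ z, deriv f11 (z 0) * pd F z (m + 1) = pd f12 z m := by
    refine mul_pd_eq_pd_of_total_derivative (A := fun z => deriv f11 (z 0))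
      (G := fun z => η * f32 z - f31 (z 0) * f22 z) (mono (hz0 _)) hdep12 ?_ hFd ?_
    · intro z w hzw
      simp only [hdep32 z w hzw, mono hdep22 z w hzw, mono (hz0 f31) z w hzw]
    · intro z
      linarith [(hS z).1]
  have top32 : ∀ z, deriv f31 (z 0) * pd F z (m + 1) = pd f32 z m := by
    refine mul_pd_eq_pd_of_total_derivative (A := fun z => deriv f31 (z 0))
      (G := fun z => η * f12 z - f11 (z 0) * f22 z) (mono (hz0 _)) hdep32 ?_ hFd ?_
    · intro z w hzw
      simp only [hdep12 z w hzw, mono hdep22 z w hzw, mono (hz0 f11) z w hzw]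
    · intro z
      linarith [(hS z).2.2]
  have hcodm : ∀ z, (-fderiv ℝ a p (1, 0) + 2 * b p * f31 (z 0)) * pd f12 z m
      + ((a p - c p) * η - 2 * b p * f11 (z 0)) * pd f32 z m = 0 := by
    intro z
    have h1 := ((hasDerivAt_comp_line (hf12.differentiable (by simp)) z m).const_mul
      (-fderiv ℝ a p (1, 0) + 2 * b p * f31 (z 0))).add
      ((hasDerivAt_comp_line (hf32.differentiable (by simp)) z m).const_mul
      ((a p - c p) * η - 2 * b p * f11 (z 0)))
    refine h1.unique ((hasDerivAt_const (0 : ℝ) (-(f11 (z 0) * fderiv ℝ a p (0, 1)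
      + η * fderiv ℝ b p (0, 1) - f22 z * fderiv ℝ b p (1, 0)
      - (a p - c p) * (f31 (z 0) * f22 z)))).congr_of_eventuallyEq
      (Filter.Eventually.of_forall fun s => ?_))
    have hs := (hcod p hp
      (z + s • fun j : Fin (m + 1 + 1) => if (j : ℕ) = m then (1 : ℝ) else 0)).1
    rw [hdep22.line le_rfl, (hz0 f11).line le_rfl, (hz0 f31).line le_rfl] at hs
    simp only [Pi.add_apply]
    linear_combination hs
  have hrel : ∀ x, -fderiv ℝ a p (1, 0) * deriv f11 x + (a p - c p) * η * deriv f31 x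
      + -(2 * b p) * (f11 x * deriv f31 x - f31 x * deriv f11 x) = 0 := by
    intro x
    have h := hcodm fun _ => x
    rw [← top12, ← top32] at h
    apply mul_right_cancel₀ (hFk fun _ => x)
    linear_combination h
  obtain ⟨hac, hb⟩ := coeff_eq_zero_of_hyperbola (hf11.differentiable (by simp))
    (hf31.differentiable (by simp)) hC hC31 hL hrel
  have hac' : a p = c p := sub_eq_zero.mp ((mul_eq_zero.mp hac).resolve_right hη)
  have hb' : b p = 0 := by linarith
  have hg := hgauss p hp
  rw [hac', hb'] at hg
  nlinarith [sq_nonneg (c p)]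
end

section
/- Suppose the functions H := f11·f11′ − f31·f31′ and L := f11·f31′ − f31·f11′ are both nowhere zero. Assume the structure equations (S1)–(S3) hold and ∂F/∂z_k is nowhere zero. Then there exist no smooth functions a, b, c on any nonempty open set U ⊆ ℝ² satisfying the Codazzi identities (C1), (C2) and the Gauss equation a·c − b² = −1. -/
open Real Finset

/-- The `i`-th coordinate direction. -/
def dir (n i : ℕ) : Fin n → ℝ := fun j => if (j : ℕ) = i then 1 else 0

lemma hasDerivAt_line {n : ℕ} {f : (Fin n → ℝ) → ℝ} (hf : Differentiable ℝ f)
    (z : Fin n → ℝ) (i : ℕ) (s : ℝ) :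
    HasDerivAt (fun s : ℝ => f (z + s • dir n i)) (pd f (z + s • dir n i) i) s := by
  have h : HasDerivAt (fun s : ℝ => z + s • dir n i) (dir n i) s := by
    simpa using ((hasDerivAt_id s).smul_const (dir n i)).const_add z
  exact (hf (z + s • dir n i)).hasFDerivAt.comp_hasDerivAt s h

lemma hasDerivAt_line_zero {n : ℕ} {f : (Fin n → ℝ) → ℝ} (hf : Differentiable ℝ f)
    (z : Fin n → ℝ) (i : ℕ) :
    HasDerivAt (fun s : ℝ => f (z + s • dir n i)) (pd f z i) 0 := by
  simpa using hasDerivAt_line hf z i 0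

lemma line_eq_of_pd_eq_zero {n : ℕ} {f : (Fin n → ℝ) → ℝ} (hf : Differentiable ℝ f) {i : ℕ}
    (h : ∀ z, pd f z i = 0) (z : Fin n → ℝ) (s : ℝ) : f (z + s • dir n i) = f z := by
  have key := is_const_of_deriv_eq_zero (fun s => (hasDerivAt_line hf z i s).differentiableAt)
    (fun s => by rw [(hasDerivAt_line hf z i s).deriv, h]) s 0
  simpa using key

lemma DependsOnFirst.line_eq {n m i : ℕ} {f : (Fin n → ℝ) → ℝ} (h : DependsOnFirst m f)
    (hi : m ≤ i) (z : Fin n → ℝ) (s : ℝ) : f (z + s • dir n i) = f z := by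
  refine h _ _ fun j hj => ?_
  have : (j : ℕ) ≠ i := by omega
  simp [dir, this]

lemma pd_line_eq {n i : ℕ} {f : (Fin n → ℝ) → ℝ} (h : ∀ z (s : ℝ), f (z + s • dir n i) = f z)
    (z : Fin n → ℝ) (s : ℝ) (j : ℕ) : pd f (z + s • dir n i) j = pd f z j := by
  unfold pd
  rw [← fderiv_comp_add_right, funext fun w => h w s]

lemma sum_pd_line {n N : ℕ} (hN : N + 1 < n) {f : (Fin n → ℝ) → ℝ}
    (h : ∀ z (s : ℝ), f (z + s • dir n (N + 1)) = f z) (z : Fin n → ℝ) (s : ℝ) :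
    ∑ i ∈ range (N + 1), pd f (z + s • dir n (N + 1)) i * zc (z + s • dir n (N + 1)) (i + 1) =
      ∑ i ∈ range (N + 1), pd f z i * zc z (i + 1) + s * pd f z N := by
  simp only [pd_line_eq h, sum_range_succ _ N]
  have hlt : ∀ i ∈ range N, pd f z i * zc (z + s • dir n (N + 1)) (i + 1) =
      pd f z i * zc z (i + 1) := by
    intro i hi
    have : i ≠ N := (mem_range.1 hi).ne
    simp [zc, dir, this]
  rw [sum_congr rfl hlt]
  simp [zc, dir, hN]
  ring

lemma hasDerivAt_zero_of_eq_affine {g : ℝ → ℝ} {u v : ℝ} (h : ∀ s, g s = u + s * v) :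
    HasDerivAt g v 0 := by
  rw [funext h]
  simpa using ((hasDerivAt_id (0 : ℝ)).mul_const v).const_add u

lemma line_apply_zero {n i : ℕ} (hi : i ≠ 0) (z : Fin (n + 1) → ℝ) (s : ℝ) :
    (z + s • dir (n + 1) i) 0 = z 0 := by
  simp [dir, hi.symm]

lemma eq_zero_of_affine_comp_eq_zero {h : ℝ → ℝ} (hd : Differentiable ℝ h)
    (h0 : ∀ s, deriv h s ≠ 0) {α β : ℝ} (H : ∀ s, α * h s + β = 0) : α = 0 ∧ β = 0 := by
  have hα : α = 0 := by
    have h1 : HasDerivAt (fun s => α * h s + β) (α * deriv h 0) 0 :=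
      ((hd 0).hasDerivAt.const_mul α).add_const β
    rw [funext H] at h1
    exact (mul_eq_zero.1 (h1.unique (hasDerivAt_const _ _))).resolve_right (h0 0)
  refine ⟨hα, ?_⟩
  simpa [hα] using H 0

lemma eq_zero_of_quadratic_comp_eq_zero {h : ℝ → ℝ} (hd : Differentiable ℝ h)
    (h0 : ∀ s, deriv h s ≠ 0) {α β γ : ℝ} (H : ∀ s, α * h s ^ 2 + β * h s + γ = 0) : α = 0 := by
  have : ∀ s, (2 * α) * h s + β = 0 := by
    intro s
    have h1 : HasDerivAt (fun s => α * h s ^ 2 + β * h s + γ)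
        (α * (2 * h s * deriv h s) + β * deriv h s) s := by
      refine ((((hd s).hasDerivAt.fun_pow 2).const_mul α).fun_add
        ((hd s).hasDerivAt.const_mul β)).add_const γ |>.congr_deriv ?_
      norm_num
    rw [funext H] at h1
    have h2 := h1.unique (hasDerivAt_const _ _)
    apply (mul_eq_zero.1 (_ : _ * deriv h s = 0)).resolve_right (h0 s)
    linear_combination h2
  linarith [(eq_zero_of_affine_comp_eq_zero hd h0 this).1]

/-- If `g` has nowhere vanishing derivative and is a fractional linear function of `h` in two ways
whose leading coefficients are shared, then the denominators degenerate. -/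
lemma fractional_linear_degenerate {g h : ℝ → ℝ} (hg : Differentiable ℝ g)
    (hh : Differentiable ℝ h) (hg0 : ∀ s, deriv g s ≠ 0) (hh0 : ∀ s, deriv h s ≠ 0)
    {η P Q A B C E : ℝ} (hη : η ≠ 0)
    (h1 : ∀ s, g s * (η * Q + h s * P) = h s * A + η * B)
    (h2 : ∀ s, g s * (h s * Q + E) = h s * B + C) : P = 0 ∧ Q = 0 := by
  have hAB : A * Q - B * P = 0 := by
    refine eq_zero_of_quadratic_comp_eq_zero hh hh0
      (β := A * E + η * B * Q - B * η * Q - C * P) (γ := η * B * E - C * η * Q) fun s => ?_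
    linear_combination (-(h s * Q + E)) * h1 s + (η * Q + h s * P) * h2 s
  by_contra hPQ
  have hne : P ^ 2 + Q ^ 2 ≠ 0 := fun h0 => hPQ ⟨by nlinarith, by nlinarith⟩
  obtain ⟨r, hA, hB⟩ : ∃ r, A = r * P ∧ B = r * Q := by
    refine ⟨(A * P + B * Q) / (P ^ 2 + Q ^ 2), ?_, ?_⟩ <;> field_simp
    · linear_combination Q * hAB
    · linear_combination (-P) * hAB
  have hw : ∀ s, P * h s + η * Q = 0 := by
    intro s
    have h3 : HasDerivAt (fun s => (g s - r) * (P * h s + η * Q))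
        (deriv g s * (P * h s + η * Q) + (g s - r) * (P * deriv h s)) s :=
      ((hg s).hasDerivAt.sub_const r).mul (((hh s).hasDerivAt.const_mul P).add_const _)
    have h4 : ∀ s, (g s - r) * (P * h s + η * Q) = 0 := fun s => by
      linear_combination h1 s + h s * hA + η * hB
    rw [funext h4] at h3
    have h5 := h3.unique (hasDerivAt_const _ _)
    have h6 : deriv g s * (P * h s + η * Q) ^ 2 = 0 := by
      linear_combination (P * h s + η * Q) * h5 - P * deriv h s * h4 s
    simpa using (mul_eq_zero.1 h6).resolve_left (hg0 s)
  obtain ⟨hP, hQ⟩ := eq_zero_of_affine_comp_eq_zero hh hh0 hw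
  exact hPQ ⟨hP, (mul_eq_zero.1 hQ).resolve_left hη⟩

/-- The top-order parts of the three structure equations. -/
lemma StructEqs.pd_top {l : ℕ} {η : ℝ} {f11 f31 : ℝ → ℝ} {f12 f22 f32 F : (Fin (l + 3) → ℝ) → ℝ}
    (hS : StructEqs (l + 2) η f11 f31 f12 f22 f32 F)
    (hf12 : Differentiable ℝ f12) (hf32 : Differentiable ℝ f32) (hF : Differentiable ℝ F)
    (hdep12 : DependsOnFirst (l + 2) f12) (hdep32 : DependsOnFirst (l + 2) f32)
    (hdep22 : DependsOnFirst (l + 1) f22) (z : Fin (l + 3) → ℝ) :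
    deriv f11 (z 0) * pd F z (l + 2) = pd f12 z (l + 1) ∧
    pd f22 z l = f11 (z 0) * pd f32 z (l + 1) - f31 (z 0) * pd f12 z (l + 1) ∧
    deriv f31 (z 0) * pd F z (l + 2) = pd f32 z (l + 1) := by
  have h12 := hdep12.line_eq (i := l + 2) le_rfl
  have h32 := hdep32.line_eq (i := l + 2) le_rfl
  have h22 := hdep22.line_eq (i := l + 2) (by omega)
  have h22' := hdep22.line_eq (i := l + 1) le_rfl
  refine ⟨?_, ?_, ?_⟩
  · refine ((hasDerivAt_line_zero hF z (l + 2)).const_mul (deriv f11 (z 0))).unique ?_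
    refine hasDerivAt_zero_of_eq_affine (u := deriv f11 (z 0) * F z) fun s => ?_
    have e := (hS (z + s • dir (l + 3) (l + 2))).1
    rw [sum_pd_line (by omega) h12, h32, h22, line_apply_zero (by omega)] at e
    linear_combination e - (hS z).1
  · refine HasDerivAt.unique ?_ (((hasDerivAt_line_zero hf32 z (l + 1)).const_mul (f11 (z 0))).sub
      ((hasDerivAt_line_zero hf12 z (l + 1)).const_mul (f31 (z 0))))
    refine hasDerivAt_zero_of_eq_affine
      (u := f11 (z 0) * f32 z - f31 (z 0) * f12 z) fun s => ?_
    have e := (hS (z + s • dir (l + 3) (l + 1))).2.1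
    have e0 := (hS z).2.1
    simp only [Nat.add_succ_sub_one] at e e0
    rw [sum_pd_line (by omega) h22', line_apply_zero (by omega)] at e
    simp only [Pi.sub_apply]
    linear_combination e0 - e
  · refine ((hasDerivAt_line_zero hF z (l + 2)).const_mul (deriv f31 (z 0))).unique ?_
    refine hasDerivAt_zero_of_eq_affine (u := deriv f31 (z 0) * F z) fun s => ?_
    have e := (hS (z + s • dir (l + 3) (l + 2))).2.2
    rw [sum_pd_line (by omega) h32, h12, h22, line_apply_zero (by omega)] at e
    linear_combination e - (hS z).2.2

/-- Proposition 5 of the paper.  In branch V (`H = f11·f11' − f31·f31'`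
and `L = f11·f31' − f31·f11'` both nowhere zero), under the structure equations with
`∂F/∂z_k` nowhere zero, no smooth `a, b, c` on a nonempty open set satisfy the Codazzi
identities and the Gauss equation. -/
theorem stmt8 (k : ℕ) (hk : 2 ≤ k) (η : ℝ) (hη : η ≠ 0)
    (f11 f31 : ℝ → ℝ) (f12 f22 f32 F : (Fin (k+1) → ℝ) → ℝ)
    (hf11 : ContDiff ℝ (⊤ : ℕ∞) f11) (hf31 : ContDiff ℝ (⊤ : ℕ∞) f31)
    (hf12 : ContDiff ℝ (⊤ : ℕ∞) f12) (hf22 : ContDiff ℝ (⊤ : ℕ∞) f22)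
    (hf32 : ContDiff ℝ (⊤ : ℕ∞) f32) (hF : ContDiff ℝ (⊤ : ℕ∞) F)
    (hdep12 : DependsOnFirst k f12) (hdep32 : DependsOnFirst k f32)
    (hdep22 : DependsOnFirst (k-1) f22)
    (hH : ∀ z0 : ℝ, f11 z0 * deriv f11 z0 - f31 z0 * deriv f31 z0 ≠ 0)
    (hL : ∀ z0 : ℝ, f11 z0 * deriv f31 z0 - f31 z0 * deriv f11 z0 ≠ 0)
    (hS : StructEqs k η f11 f31 f12 f22 f32 F)
    (hFk : ∀ z : Fin (k+1) → ℝ, pd F z k ≠ 0) :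
    ¬ ∃ (U : Set (ℝ × ℝ)) (a b c : ℝ × ℝ → ℝ),
      U.Nonempty ∧ IsOpen U ∧
      ContDiffOn ℝ (⊤ : ℕ∞) a U ∧ ContDiffOn ℝ (⊤ : ℕ∞) b U ∧
      ContDiffOn ℝ (⊤ : ℕ∞) c U ∧
      Codazzi k η f11 f31 f12 f22 f32 U a b c ∧
      (∀ p ∈ U, a p * c p - (b p) ^ 2 = -1) := by
  obtain ⟨l, rfl⟩ : ∃ l, k = l + 2 := ⟨k - 2, by omega⟩
  rintro ⟨U, a, b, c, ⟨p, hp⟩, -, -, -, -, hC, hG⟩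
  replace hC := hC p hp
  replace hG := hG p hp
  generalize fderiv ℝ a p (0, 1) = a_t, fderiv ℝ a p (1, 0) = a_x, fderiv ℝ b p (0, 1) = b_t,
    fderiv ℝ b p (1, 0) = b_x, fderiv ℝ c p (0, 1) = c_t, fderiv ℝ c p (1, 0) = c_x,
    a p = a₀, b p = b₀, c p = c₀ at hC hG
  have d11 := hf11.differentiable (by simp)
  have d31 := hf31.differentiable (by simp)
  have d12 := hf12.differentiable (by simp)
  have d22 := hf22.differentiable (by simp)
  have d32 := hf32.differentiable (by simp)
  have hT := hS.pd_top d12 d32 (hF.differentiable (by simp)) hdep12 hdep32 hdep22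
  have hD : (a₀ - c₀) ^ 2 + (2 * b₀) ^ 2 ≠ 0 := fun h => by nlinarith [sq_nonneg (a₀ + c₀)]
  -- the coefficients of `z_{k-1}` in the Codazzi identities
  have hX : ∀ x, -a_x * deriv f11 x - 2 * b₀ * (f11 x * deriv f31 x - f31 x * deriv f11 x)
        + (a₀ - c₀) * η * deriv f31 x = 0 ∧
      -b_x * deriv f11 x + (a₀ - c₀) * (f11 x * deriv f31 x - f31 x * deriv f11 x)
        + 2 * b₀ * η * deriv f31 x = 0 := by
    intro x
    let z : Fin (l + 3) → ℝ := fun _ => x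
    have h22 := hdep22.line_eq (i := l + 1) le_rfl z
    have hd12 := hasDerivAt_line_zero d12 z (l + 1)
    have hd32 := hasDerivAt_line_zero d32 z (l + 1)
    obtain ⟨t1, -, t3⟩ := hT z
    have hz : ∀ s : ℝ, (z + s • dir (l + 3) (l + 1)) 0 = x := line_apply_zero (by omega) z
    have hlin : ∀ u v w : ℝ,
        (∀ s : ℝ, u * f12 (z + s • dir _ (l + 1)) + v * f32 (z + s • dir _ (l + 1)) + w = 0) →
        u * deriv f11 x + v * deriv f31 x = 0 := by
      intro u v w h
      have hd := ((hd12.const_mul u).add (hd32.const_mul v)).add_const w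
      have hd0 := hd.congr_of_eventuallyEq
        (f₁ := fun _ => (0 : ℝ)) (Filter.Eventually.of_forall fun s => (h s).symm)
      have h0 := hd0.unique (hasDerivAt_const _ _)
      rw [← t1, ← t3] at h0
      refine (mul_eq_zero.1 ?_).resolve_right (hFk z)
      linear_combination h0
    constructor
    · have := hlin (-a_x + 2 * b₀ * f31 x) (-2 * b₀ * f11 x + (a₀ - c₀) * η)
        (f11 x * a_t + η * b_t - f22 z * b_x - (a₀ - c₀) * f31 x * f22 z) fun s => by
          have e := (hC (z + s • dir (l + 3) (l + 1))).1
          rw [hz, h22] at e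
          linear_combination e
      linear_combination this
    · have := hlin (-b_x - (a₀ - c₀) * f31 x) ((a₀ - c₀) * f11 x + 2 * b₀ * η)
        (f11 x * b_t + η * c_t - f22 z * c_x - 2 * b₀ * f31 x * f22 z) fun s => by
          have e := (hC (z + s • dir (l + 3) (l + 1))).2
          rw [hz, h22] at e
          linear_combination e
      linear_combination this
  have h11 : ∀ x, deriv f11 x ≠ 0 := by
    intro x h0
    obtain ⟨e1, e2⟩ := hX x
    rw [h0] at e1 e2
    refine hL x ((mul_eq_zero.1 ?_).resolve_left hD)
    rw [h0]
    linear_combination (a₀ - c₀) * e2 - 2 * b₀ * e1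
  obtain ⟨m, hm⟩ : ∃ m, ∀ x, deriv f31 x = m * deriv f11 x := by
    refine ⟨((a₀ - c₀) * a_x + 2 * b₀ * b_x) / (η * ((a₀ - c₀) ^ 2 + (2 * b₀) ^ 2)), fun x => ?_⟩
    obtain ⟨e1, e2⟩ := hX x
    rw [div_mul_eq_mul_div, eq_div_iff (mul_ne_zero hη hD)]
    linear_combination (a₀ - c₀) * e1 + 2 * b₀ * e2
  obtain ⟨n, hn⟩ : ∃ n, ∀ x, f31 x = m * f11 x + n := by
    refine ⟨f31 0 - m * f11 0, fun x => ?_⟩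
    have := is_const_of_deriv_eq_zero (f := fun x => f31 x - m * f11 x)
      (d31.sub (d11.const_mul m)) (fun x => by
        have := (d31 x).hasDerivAt.sub ((d11 x).hasDerivAt.const_mul m)
        rw [hm, sub_self] at this
        exact this.deriv) x 0
    linear_combination this
  have hn0 : n ≠ 0 := by
    rintro rfl
    exact hL 0 (by rw [hm, hn]; ring)
  have hax : a_x = (a₀ - c₀) * η * m + 2 * b₀ * n := by
    refine mul_right_cancel₀ (h11 0) ?_
    have e := (hX 0).1
    rw [hm, hn] at e
    linear_combination -e
  have hbx : b_x = 2 * b₀ * η * m - (a₀ - c₀) * n := by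
    refine mul_right_cancel₀ (h11 0) ?_
    have e := (hX 0).2
    rw [hm, hn] at e
    linear_combination -e
  have p22 : ∀ z, pd f22 z l = -n * pd f12 z (l + 1) := by
    intro z
    obtain ⟨t1, t2, t3⟩ := hT z
    rw [t2, ← t3, ← t1, hm, hn]
    ring
  have p22_ne : ∀ z, pd f22 z l ≠ 0 := by
    intro z
    rw [p22, ← (hT z).1]
    exact mul_ne_zero (neg_ne_zero.2 hn0) (mul_ne_zero (h11 _) (hFk z))
  have pd_comb : ∀ (f g : (Fin (l + 3) → ℝ) → ℝ) (r : ℝ), Differentiable ℝ f →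
      Differentiable ℝ g → ∀ z i, pd (fun w => f w + r * g w) z i = pd f z i + r * pd g z i := by
    intro f g r hf hg z i
    have := (hf z).hasFDerivAt.add ((hg z).hasFDerivAt.const_mul r)
    simp only [pd]
    erw [this.fderiv]
    simp
  -- `φ = f32 - m f12` does not depend on `z_{k-1}`
  set φ : (Fin (l + 3) → ℝ) → ℝ := fun w => f32 w + (-m) * f12 w with hφ
  have dφ : Differentiable ℝ φ := d32.add (d12.const_mul _)
  have pφ : ∀ z i, pd φ z i = pd f32 z i + (-m) * pd f12 z i := pd_comb _ _ _ d32 d12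
  have pφ0 : ∀ z, pd φ z (l + 1) = 0 := by
    intro z
    obtain ⟨t1, t2, t3⟩ := hT z
    rw [pφ, ← t1, ← t3, hm]
    ring
  have hφline := line_eq_of_pd_eq_zero dφ pφ0
  have hSφ : ∀ z, ∑ i ∈ range (l + 1), pd φ z i * zc z (i + 1) =
      η * m * φ z + η * (m ^ 2 - 1) * f12 z + (f11 (z 0) - m * f31 (z 0)) * f22 z := by
    intro z
    obtain ⟨s1, -, s3⟩ := hS z
    have e : ∑ i ∈ range (l + 2), pd φ z i * zc z (i + 1) =
        ∑ i ∈ range (l + 2), pd f32 z i * zc z (i + 1) -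
          m * ∑ i ∈ range (l + 2), pd f12 z i * zc z (i + 1) := by
      rw [mul_sum, ← sum_sub_distrib]
      exact sum_congr rfl fun i _ => by rw [pφ]; ring
    rw [sum_range_succ, pφ0, zero_mul, add_zero] at e
    rw [hm] at s3
    rw [e]
    simp only [hφ]
    linear_combination m * s1 - s3
  have pφl : ∀ z, pd φ z l = η * (m ^ 2 - 1) * pd f12 z (l + 1) := by
    intro z
    have h1 := (hasDerivAt_line_zero d12 z (l + 1)).const_mul (η * (m ^ 2 - 1))
    refine (hasDerivAt_zero_of_eq_affine (u := η * (m ^ 2 - 1) * f12 z) fun s => ?_).unique h1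
    have e := hSφ (z + s • dir (l + 3) (l + 1))
    rw [sum_pd_line (by omega) hφline, hφline, line_apply_zero (by omega),
      hdep22.line_eq (i := l + 1) le_rfl] at e
    linear_combination hSφ z - e
  obtain ⟨q, hq⟩ : ∃ q, q * n = η * (m ^ 2 - 1) := ⟨η * (m ^ 2 - 1) / n, by field_simp⟩
  set ψ : (Fin (l + 3) → ℝ) → ℝ := fun w => φ w + q * f22 w with hψ
  have hψline := line_eq_of_pd_eq_zero (f := ψ) (i := l) (dφ.add (d22.const_mul q)) fun z => by
    rw [pd_comb _ _ _ dφ d22, pφl, p22]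
    linear_combination (-pd f12 z (l + 1)) * hq
  have hC1 : ∀ z, f22 z * (η * (2 * b₀ * m + (a₀ - c₀) * q) +
      f11 (z 0) * ((a₀ - c₀) * m - 2 * b₀ * q)) =
      f11 (z 0) * (a_t - 2 * b₀ * ψ z) + η * (b_t + (a₀ - c₀) * ψ z) := by
    intro z
    have e := (hC z).1
    rw [hn, hax, hbx] at e
    simp only [hψ, hφ]
    linear_combination -e
  have hC2 : ∀ z, f22 z * (f11 (z 0) * (2 * b₀ * m + (a₀ - c₀) * q) +
      (c_x + 2 * b₀ * (n + q * η))) =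
      f11 (z 0) * (b_t + (a₀ - c₀) * ψ z) + η * (c_t + 2 * b₀ * ψ z) := by
    intro z
    have e := (hC z).2
    rw [hn, hbx] at e
    simp only [hψ, hφ]
    linear_combination -e
  suffices h : (a₀ - c₀) * m - 2 * b₀ * q = 0 ∧ 2 * b₀ * m + (a₀ - c₀) * q = 0 by
    obtain ⟨hP, hQ⟩ := h
    have hmq : m ^ 2 + q ^ 2 = 0 := by
      refine (mul_eq_zero.1 ?_).resolve_left hD
      linear_combination ((a₀ - c₀) * m - 2 * b₀ * q) * hP + (2 * b₀ * m + (a₀ - c₀) * q) * hQ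
    have hm0 : m = 0 := by nlinarith
    have hq0 : q = 0 := by nlinarith
    rw [hm0, hq0] at hq
    exact hη (by linarith)
  rcases Nat.eq_zero_or_pos l with rfl | hl
  · have hz : ∀ s : ℝ, ((0 : Fin 3 → ℝ) + s • dir 3 0) 0 = s := fun s => by simp [dir]
    have hg := hasDerivAt_line d22 0 0
    refine fractional_linear_degenerate (fun s => (hg s).differentiableAt) d11
      (fun s => by rw [(hg s).deriv]; exact p22_ne _) h11 hη
      (A := a_t - 2 * b₀ * ψ 0) (B := b_t + (a₀ - c₀) * ψ 0) (C := η * (c_t + 2 * b₀ * ψ 0))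
      (E := c_x + 2 * b₀ * (n + q * η)) (fun s => ?_) (fun s => ?_)
    · have e := hC1 (0 + s • dir 3 0)
      rwa [hψline, hz] at e
    · have e := hC2 (0 + s • dir 3 0)
      rwa [hψline, hz] at e
  · have hw : ∀ x, ((a₀ - c₀) * m - 2 * b₀ * q) * f11 x
        + η * (2 * b₀ * m + (a₀ - c₀) * q) = 0 := by
      intro x
      let z : Fin (l + 3) → ℝ := fun _ => x
      have hd := (hasDerivAt_line_zero d22 z l).mul_const
        (η * (2 * b₀ * m + (a₀ - c₀) * q) + f11 x * ((a₀ - c₀) * m - 2 * b₀ * q))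
      have hd0 := hd.unique ((hasDerivAt_const (0 : ℝ)
        (f11 x * (a_t - 2 * b₀ * ψ z) + η * (b_t + (a₀ - c₀) * ψ z))).congr_of_eventuallyEq
          (Filter.Eventually.of_forall fun s => by
            have e := hC1 (z + s • dir (l + 3) l)
            rwa [hψline, line_apply_zero (by omega)] at e))
      linear_combination (mul_eq_zero.1 hd0).resolve_left (p22_ne z)
    obtain ⟨hP, hQ⟩ := eq_zero_of_affine_comp_eq_zero d11 h11 hw
    exact ⟨hP, (mul_eq_zero.1 hQ).resolve_left hη⟩
end

section
/- Assume the structure equations (S1), (S2), (S3) hold. Then for every (z0,…,z_k) ∈ ℝ^{k+1}: (i) f11′(z0)·(∂F/∂z_k)(z0,…,z_k) = (∂f12/∂z_{k−1})(z0,…,z_{k−1}); (ii) f31′(z0)·(∂F/∂z_k)(z0,…,z_k) = (∂f32/∂z_{k−1})(z0,…,z_{k−1}); (iii) (∂f22/∂z_{k−2})(z0,…,z_{k−2}) = f11(z0)·(∂f32/∂z_{k−1})(z0,…,z_{k−1}) − f31(z0)·(∂f12/∂z_{k−1})(z0,…,z_{k−1}). In particular, if ∂F/∂z_k is nowhere zero,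 then f11′(z0) ≠ 0 if and only if (∂f12/∂z_{k−1})(z0,z1,…,z_{k−1}) ≠ 0 for every (z1,…,z_{k−1}), and f31′(z0) ≠ 0 if and only if (∂f32/∂z_{k−1})(z0,z1,…,z_{k−1}) ≠ 0 for every (z1,…,z_{k−1}). -/
open Real Finset

/-- The `i`-th coordinate direction, zero if `i` is out of range. -/
def coordDir (n i : ℕ) : Fin n → ℝ := fun j => if (j : ℕ) = i then 1 else 0

lemma hasDerivAt_comp_add_smul_coordDir {n : ℕ} {f : (Fin n → ℝ) → ℝ}
    (hf : Differentiable ℝ f) (z : Fin n → ℝ) (i : ℕ) :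
    HasDerivAt (fun t : ℝ => f (z + t • coordDir n i)) (pd f z i) 0 :=
  (hf z).hasFDerivAt.hasLineDerivAt _

lemma DependsOnFirst.apply_add_smul_coordDir {n m l : ℕ} {f : (Fin n → ℝ) → ℝ}
    (hf : DependsOnFirst m f) (hml : m ≤ l) (z : Fin n → ℝ) (t : ℝ) :
    f (z + t • coordDir n l) = f z := by
  refine hf _ _ fun j hj => ?_
  have hjl : (j : ℕ) ≠ l := by omega
  simp [coordDir, hjl]

lemma DependsOnFirst.pd_add_smul_coordDir {n m l : ℕ} {f : (Fin n → ℝ) → ℝ}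
    (hf : DependsOnFirst m f) (hml : m ≤ l) (z : Fin n → ℝ) (t : ℝ) (i : ℕ) :
    pd f (z + t • coordDir n l) i = pd f z i := by
  have h : (fun x => f (x + t • coordDir n l)) = f :=
    funext fun x => hf.apply_add_smul_coordDir hml x t
  rw [pd, pd, ← fderiv_comp_add_right, h]

lemma zc_add_smul_coordDir {n l : ℕ} (hl : l < n) (z : Fin n → ℝ) (t : ℝ) (i : ℕ) :
    zc (z + t • coordDir n l) i = zc z i + if i = l then t else 0 := by
  unfold zc coordDir
  split_ifs <;> first | omega | simp_all

/-- If `f` depends on `z_0, …, z_m` only, its total derivative `∑ ∂f/∂z_i · z_{i+1}` is affine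
in `z_{m+1}` with slope `∂f/∂z_m`. -/
lemma DependsOnFirst.hasDerivAt_sum_pd_mul_zc {n m : ℕ} {f : (Fin n → ℝ) → ℝ}
    (hf : DependsOnFirst (m + 1) f) (hm : m + 1 < n) (z : Fin n → ℝ) :
    HasDerivAt (fun t : ℝ => ∑ i ∈ Finset.range (m + 1),
      pd f (z + t • coordDir n (m + 1)) i * zc (z + t • coordDir n (m + 1)) (i + 1))
      (pd f z m) 0 := by
  have h : (fun t : ℝ => ∑ i ∈ Finset.range (m + 1),
      pd f (z + t • coordDir n (m + 1)) i * zc (z + t • coordDir n (m + 1)) (i + 1)) =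
      fun t => (∑ i ∈ Finset.range (m + 1), pd f z i * zc z (i + 1)) + pd f z m * t := by
    funext t
    simp [hf.pd_add_smul_coordDir le_rfl, zc_add_smul_coordDir hm, mul_add,
      Finset.sum_add_distrib]
  rw [h]
  simpa using ((hasDerivAt_id (0 : ℝ)).const_mul (pd f z m)).const_add
    (∑ i ∈ Finset.range (m + 1), pd f z i * zc z (i + 1))

/-- The equation `a F = D f + b g - c h`, with `D` the total derivative, differentiated in `z_{m+1}`. -/
lemma mul_pd_eq_pd_of_structEq {m : ℕ} {a b c : ℝ → ℝ} {f g h F : (Fin (m + 2) → ℝ) → ℝ}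
    (hF : Differentiable ℝ F) (hf : DependsOnFirst (m + 1) f) (hg : DependsOnFirst (m + 1) g)
    (hh : DependsOnFirst m h)
    (hS : ∀ z : Fin (m + 2) → ℝ, a (z 0) * F z =
      (∑ i ∈ Finset.range (m + 1), pd f z i * zc z (i + 1)) + b (z 0) * g z - c (z 0) * h z)
    (z : Fin (m + 2) → ℝ) : a (z 0) * pd F z (m + 1) = pd f z m := by
  have h0 : ∀ t : ℝ, (z + t • coordDir (m + 2) (m + 1)) 0 = z 0 := by
    intro t; simp [coordDir]
  have hl := (hasDerivAt_comp_add_smul_coordDir hF z (m + 1)).const_mul (a (z 0))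
  have hr := ((hf.hasDerivAt_sum_pd_mul_zc (by omega) z).add_const (b (z 0) * g z)).sub_const
    (c (z 0) * h z)
  refine hl.unique (hr.congr_of_eventuallyEq (.of_forall fun t => ?_))
  have := hS (z + t • coordDir (m + 2) (m + 1))
  rwa [h0, hg.apply_add_smul_coordDir le_rfl, hh.apply_add_smul_coordDir (by omega)] at this

/-- The equation `D f = a g - b h`, with `D` the total derivative, differentiated in `z_{m+1}`. -/
lemma pd_eq_of_structEq {n m : ℕ} {a b : ℝ → ℝ} {f g h : (Fin (n + 1) → ℝ) → ℝ}
    (hm : m < n) (hg : Differentiable ℝ g) (hh : Differentiable ℝ h)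
    (hf : DependsOnFirst (m + 1) f)
    (hS : ∀ z : Fin (n + 1) → ℝ, (∑ i ∈ Finset.range (m + 1), pd f z i * zc z (i + 1)) =
      a (z 0) * g z - b (z 0) * h z)
    (z : Fin (n + 1) → ℝ) :
    pd f z m = a (z 0) * pd g z (m + 1) - b (z 0) * pd h z (m + 1) := by
  have h0 : ∀ t : ℝ, (z + t • coordDir (n + 1) (m + 1)) 0 = z 0 := by
    intro t; simp [coordDir]
  have hr := ((hasDerivAt_comp_add_smul_coordDir hg z (m + 1)).const_mul (a (z 0))).sub
    ((hasDerivAt_comp_add_smul_coordDir hh z (m + 1)).const_mul (b (z 0)))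
  refine (hf.hasDerivAt_sum_pd_mul_zc (by omega) z).unique
    (hr.congr_of_eventuallyEq (.of_forall fun t => ?_))
  have := hS (z + t • coordDir (n + 1) (m + 1))
  rwa [h0] at this

lemma ne_zero_iff_forall_of_mul_eq {n : ℕ} {a : ℝ → ℝ} {u v : (Fin (n + 1) → ℝ) → ℝ}
    (h : ∀ z, a (z 0) * u z = v z) (hu : ∀ z, u z ≠ 0) (z0 : ℝ) :
    a z0 ≠ 0 ↔ ∀ z : Fin (n + 1) → ℝ, z 0 = z0 → v z ≠ 0 := by
  constructor
  · rintro ha z rfl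
    rw [← h z]
    exact mul_ne_zero ha (hu z)
  · intro hv ha
    exact hv (fun _ => z0) rfl (by rw [← h, ha, zero_mul])

/-- Differentiating the structure equations (S1)–(S3) with respect to
the top-order variables yields the identities (i)–(iii); in particular, when `∂F/∂z_k`
is nowhere zero, `f11'(z0) ≠ 0` iff `∂f12/∂z_{k-1} ≠ 0` along `z_0 = z0`, and
similarly for `f31'` and `f32`. -/
theorem stmt9 (k : ℕ) (hk : 2 ≤ k) (η : ℝ) (hη : η ≠ 0)
    (f11 f31 : ℝ → ℝ) (f12 f22 f32 F : (Fin (k+1) → ℝ) → ℝ)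
    (hf11 : ContDiff ℝ (⊤ : ℕ∞) f11) (hf31 : ContDiff ℝ (⊤ : ℕ∞) f31)
    (hf12 : ContDiff ℝ (⊤ : ℕ∞) f12) (hf22 : ContDiff ℝ (⊤ : ℕ∞) f22)
    (hf32 : ContDiff ℝ (⊤ : ℕ∞) f32) (hF : ContDiff ℝ (⊤ : ℕ∞) F)
    (hdep12 : DependsOnFirst k f12) (hdep32 : DependsOnFirst k f32)
    (hdep22 : DependsOnFirst (k-1) f22)
    (hS : StructEqs k η f11 f31 f12 f22 f32 F) :
    (∀ z : Fin (k+1) → ℝ,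
      deriv f11 (z 0) * pd F z k = pd f12 z (k-1) ∧
      deriv f31 (z 0) * pd F z k = pd f32 z (k-1) ∧
      pd f22 z (k-2) = f11 (z 0) * pd f32 z (k-1) - f31 (z 0) * pd f12 z (k-1)) ∧
    ((∀ z : Fin (k+1) → ℝ, pd F z k ≠ 0) →
      (∀ z0 : ℝ, deriv f11 z0 ≠ 0 ↔
        ∀ z : Fin (k+1) → ℝ, z 0 = z0 → pd f12 z (k-1) ≠ 0) ∧
      (∀ z0 : ℝ, deriv f31 z0 ≠ 0 ↔
        ∀ z : Fin (k+1) → ℝ, z 0 = z0 → pd f32 z (k-1) ≠ 0)) := by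
  obtain ⟨m, rfl⟩ : ∃ m, k = m + 2 := ⟨k - 2, by omega⟩
  have hne : ((⊤ : ℕ∞) : WithTop ℕ∞) ≠ 0 := by simp
  have h1 := mul_pd_eq_pd_of_structEq (a := deriv f11) (b := fun _ => η)
    (hF.differentiable hne) hdep12 hdep32 hdep22 fun z => (hS z).1
  have h3 := mul_pd_eq_pd_of_structEq (a := deriv f31) (b := fun _ => η)
    (hF.differentiable hne) hdep32 hdep12 hdep22 fun z => (hS z).2.2
  have h2 := pd_eq_of_structEq (n := m + 2) (by omega) (hf32.differentiable hne)
    (hf12.differentiable hne) hdep22 fun z => (hS z).2.1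
  exact ⟨fun z => ⟨h1 z, h3 z, h2 z⟩, fun hpd =>
    ⟨ne_zero_iff_forall_of_mul_eq h1 hpd, ne_zero_iff_forall_of_mul_eq h3 hpd⟩⟩
end

section
/- Suppose f11 is identically zero and f31′ is nowhere zero. Assume the structure equations (S1)–(S3) hold and ∂F/∂z_k is nowhere zero. Then at every point: ∂f12/∂z_{k−1} = 0, ∂f22/∂z_{k−2} = 0, and (∂f32/∂z_{k−1})(z0,…,z_{k−1}) = f31′(z0)·(∂F/∂z_k)(z0,…,z_k), which is nonzero. -/
open Real Finset

/-- The `m`-th standard coordinate direction (zero if `m` is out of range). -/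
def coordVec (n m : ℕ) : Fin n → ℝ := fun j => if (j : ℕ) = m then 1 else 0

lemma pd_eq_fderiv_coordVec {n : ℕ} (f : (Fin n → ℝ) → ℝ) (z : Fin n → ℝ) (m : ℕ) :
    pd f z m = fderiv ℝ f z (coordVec n m) := rfl

lemma DependsOnFirst.add_smul_coordVec {n m p : ℕ} {f : (Fin n → ℝ) → ℝ}
    (hf : DependsOnFirst m f) (hmp : m ≤ p) (t : ℝ) (z : Fin n → ℝ) :
    f (z + t • coordVec n p) = f z := by
  refine hf _ _ fun j hj => ?_
  have : (j : ℕ) ≠ p := by omega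
  simp [coordVec, this]

lemma pd_add_of_periodic {n : ℕ} {f : (Fin n → ℝ) → ℝ} {v : Fin n → ℝ}
    (hf : ∀ z, f (z + v) = f z) (z : Fin n → ℝ) (i : ℕ) : pd f (z + v) i = pd f z i := by
  have h : (fun z => f (z + v)) = f := funext hf
  rw [pd_eq_fderiv_coordVec, pd_eq_fderiv_coordVec, ← fderiv_comp_add_right, h]

lemma zc_add_smul_coordVec {n m : ℕ} (hm : m < n) (t : ℝ) (z : Fin n → ℝ) (i : ℕ) :
    zc (z + t • coordVec n m) i = zc z i + if i = m then t else 0 := by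
  unfold zc coordVec
  by_cases hi : i < n
  · simp [hi]
  · have : i ≠ m := by omega
    simp [hi, this]

/-- Shifting the top variable changes a total derivative by the top coefficient. -/
lemma sum_pd_mul_zc_shift {n m : ℕ} (hm : m + 1 < n) {f : (Fin n → ℝ) → ℝ} {t : ℝ}
    (hf : ∀ z, f (z + t • coordVec n (m + 1)) = f z) (z : Fin n → ℝ) :
    (∑ i ∈ Finset.range (m + 1), pd f (z + t • coordVec n (m + 1)) i *
        zc (z + t • coordVec n (m + 1)) (i + 1)) =
      (∑ i ∈ Finset.range (m + 1), pd f z i * zc z (i + 1)) + pd f z m * t := by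
  simp [pd_add_of_periodic hf, zc_add_smul_coordVec hm, mul_add, Finset.sum_add_distrib]

lemma hasDerivAt_add_smul_coordVec {n : ℕ} {f : (Fin n → ℝ) → ℝ} (hf : Differentiable ℝ f)
    (z : Fin n → ℝ) (m : ℕ) (t : ℝ) :
    HasDerivAt (fun s : ℝ => f (z + s • coordVec n m)) (pd f (z + t • coordVec n m) m) t := by
  have hline : HasDerivAt (fun s : ℝ => z + s • coordVec n m) (coordVec n m) t := by
    simpa using ((hasDerivAt_id t).smul_const (coordVec n m)).const_add z
  exact (hf _).hasFDerivAt.comp_hasDerivAt t hline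

lemma add_smul_coordVec_of_pd_eq_zero {n m : ℕ} {f : (Fin n → ℝ) → ℝ} (hf : Differentiable ℝ f)
    (h : ∀ z, pd f z m = 0) (t : ℝ) (z : Fin n → ℝ) : f (z + t • coordVec n m) = f z := by
  have hd := hasDerivAt_add_smul_coordVec hf z m
  simpa using is_const_of_deriv_eq_zero (fun s => (hd s).differentiableAt)
    (fun s => (hd s).deriv.trans (h _)) t 0

/-- If `f11 ≡ 0` and `f31'` is nowhere zero, the structure
equations with `∂F/∂z_k` nowhere zero force `∂f12/∂z_{k-1} = 0`,
`∂f22/∂z_{k-2} = 0`, and `∂f32/∂z_{k-1} = f31'(z0)·∂F/∂z_k ≠ 0`. -/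
theorem stmt11 (k : ℕ) (hk : 2 ≤ k) (η : ℝ) (hη : η ≠ 0)
    (f11 f31 : ℝ → ℝ) (f12 f22 f32 F : (Fin (k+1) → ℝ) → ℝ)
    (hf11 : ContDiff ℝ (⊤ : ℕ∞) f11) (hf31 : ContDiff ℝ (⊤ : ℕ∞) f31)
    (hf12 : ContDiff ℝ (⊤ : ℕ∞) f12) (hf22 : ContDiff ℝ (⊤ : ℕ∞) f22)
    (hf32 : ContDiff ℝ (⊤ : ℕ∞) f32) (hF : ContDiff ℝ (⊤ : ℕ∞) F)
    (hdep12 : DependsOnFirst k f12) (hdep32 : DependsOnFirst k f32)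
    (hdep22 : DependsOnFirst (k-1) f22)
    (hS : StructEqs k η f11 f31 f12 f22 f32 F)
    (hFk : ∀ z : Fin (k+1) → ℝ, pd F z k ≠ 0)
    (h11 : ∀ z0 : ℝ, f11 z0 = 0) (h31d : ∀ z0 : ℝ, deriv f31 z0 ≠ 0) :
    ∀ z : Fin (k+1) → ℝ,
      pd f12 z (k-1) = 0 ∧
      pd f22 z (k-2) = 0 ∧
      pd f32 z (k-1) = deriv f31 (z 0) * pd F z k ∧
      pd f32 z (k-1) ≠ 0 := by
  obtain ⟨l, rfl⟩ : ∃ l, k = l + 2 := ⟨k - 2, by omega⟩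
  have h11' : ∀ x, deriv f11 x = 0 := fun x => by
    rw [show f11 = fun _ => 0 from funext h11, deriv_const]
  have hz0 : ∀ (z : Fin (l + 2 + 1) → ℝ) (t : ℝ) (m : ℕ),
      (z + t • coordVec (l + 2 + 1) (m + 1)) 0 = z 0 := fun z t m => by simp [coordVec]
  have hlt : l + 1 + 1 < l + 2 + 1 := by omega
  have inv12 := hdep12.add_smul_coordVec le_rfl
  have inv32 := hdep32.add_smul_coordVec le_rfl
  have inv22 := hdep22.add_smul_coordVec (p := l + 2) (by omega)
  have hf12z : ∀ z, pd f12 z (l + 1) = 0 := fun z => by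
    have h0 := (hS z).1
    have h1 := (hS (z + (1 : ℝ) • coordVec (l + 2 + 1) (l + 1 + 1))).1
    rw [sum_pd_mul_zc_shift hlt (inv12 1), inv32, inv22, hz0, h11'] at h1
    rw [h11'] at h0
    linarith
  have inv12' := add_smul_coordVec_of_pd_eq_zero (hf12.differentiable (by simp)) hf12z
  have hf22z : ∀ z, pd f22 z l = 0 := fun z => by
    have inv22' := hdep22.add_smul_coordVec (p := l + 1) (by omega)
    have h0 := (hS z).2.1
    have h1 := (hS (z + (1 : ℝ) • coordVec (l + 2 + 1) (l + 1))).2.1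
    rw [show l + 2 - 1 = l + 1 by omega] at h0 h1
    rw [sum_pd_mul_zc_shift (by omega) (inv22' 1), inv12', hz0, h11] at h1
    rw [h11] at h0
    linarith
  have hf32z : ∀ z, pd f32 z (l + 1) = deriv f31 (z 0) * pd F z (l + 2) := fun z => by
    have hline : ∀ t : ℝ, deriv f31 (z 0) * F (z + t • coordVec (l + 2 + 1) (l + 2)) =
        deriv f31 (z 0) * F z + pd f32 z (l + 1) * t := fun t => by
      have h0 := (hS z).2.2
      have h1 := (hS (z + t • coordVec (l + 2 + 1) (l + 1 + 1))).2.2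
      rw [sum_pd_mul_zc_shift hlt (inv32 t), inv12, inv22, hz0, h11] at h1
      rw [h11] at h0
      linarith
    have hd := (hasDerivAt_add_smul_coordVec (hF.differentiable (by simp)) z (l + 2) 0).const_mul
      (deriv f31 (z 0))
    have hd' := ((hasDerivAt_id (0 : ℝ)).const_mul (pd f32 z (l + 1))).const_add
      (deriv f31 (z 0) * F z)
    simp only [hline, zero_smul, add_zero] at hd
    simpa using hd'.unique hd
  intro z
  exact ⟨hf12z z, hf22z z, hf32z z, by
    rw [show l + 2 - 1 = l + 1 by omega, hf32z z]
    exact mul_ne_zero (h31d _) (hFk z)⟩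
end

section
/- Suppose f31 is identically zero and f11′ is nowhere zero. Assume the structure equations (S1)–(S3) hold and ∂F/∂z_k is nowhere zero. Then at every point: ∂f32/∂z_{k−1} = 0, ∂f22/∂z_{k−2} = 0, (∂f12/∂z_{k−1})(z0,…,z_{k−1}) = f11′(z0)·(∂F/∂z_k)(z0,…,z_k), which is nonzero, and ∂f32/∂z_{k−2} = −η·∂f12/∂z_{k−1}, which is nonzero. -/
open Real Finset

/-- `f` does not depend on the `i`-th coordinate. -/
def IndepOfCoord {n : ℕ} (f : (Fin n → ℝ) → ℝ) (i : ℕ) : Prop :=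
  ∀ (z : Fin n → ℝ) (t : ℝ), f (z + t • coordDir n i) = f z

lemma DependsOnFirst.indepOfCoord {n m i : ℕ} {f : (Fin n → ℝ) → ℝ}
    (h : DependsOnFirst m f) (hi : m ≤ i) : IndepOfCoord f i := by
  intro z t
  refine h _ _ fun j hj => ?_
  have hji : (j : ℕ) ≠ i := by omega
  simp [coordDir, hji]

lemma IndepOfCoord.pd_add {n i : ℕ} {f : (Fin n → ℝ) → ℝ} (h : IndepOfCoord f i)
    (z : Fin n → ℝ) (t : ℝ) (l : ℕ) : pd f (z + t • coordDir n i) l = pd f z l := by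
  have hf : (fun w => f (w + t • coordDir n i)) = f := funext fun w => h w t
  unfold pd
  rw [← fderiv_comp_add_right, hf]

lemma hasDerivAt_comp_coordLine {n : ℕ} {f : (Fin n → ℝ) → ℝ} (hf : Differentiable ℝ f)
    (z : Fin n → ℝ) (i : ℕ) (t : ℝ) :
    HasDerivAt (fun s : ℝ => f (z + s • coordDir n i)) (pd f (z + t • coordDir n i) i) t := by
  have hline : HasDerivAt (fun s : ℝ => z + s • coordDir n i) (coordDir n i) t := by
    simpa using ((hasDerivAt_id t).smul_const (coordDir n i)).const_add z
  exact (hf _).hasFDerivAt.comp_hasDerivAt t hline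

lemma indepOfCoord_of_pd_eq_zero {n i : ℕ} {f : (Fin n → ℝ) → ℝ} (hf : Differentiable ℝ f)
    (h : ∀ z, pd f z i = 0) : IndepOfCoord f i := by
  intro z t
  have hd := hasDerivAt_comp_coordLine hf z i
  have := is_const_of_deriv_eq_zero (fun s => (hd s).differentiableAt)
    (fun s => (hd s).deriv.trans (h _)) t 0
  simpa using this

lemma pd_eq_of_affine {n i : ℕ} {f : (Fin n → ℝ) → ℝ} (hf : Differentiable ℝ f)
    {z : Fin n → ℝ} {c : ℝ} (h : ∀ t : ℝ, f (z + t • coordDir n i) = f z + t * c) :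
    pd f z i = c := by
  have hd := hasDerivAt_comp_coordLine hf z i 0
  have hc : HasDerivAt (fun s : ℝ => f (z + s • coordDir n i)) c 0 := by
    simpa [h] using ((hasDerivAt_id (0 : ℝ)).mul_const c).const_add (f z)
  simpa using hd.unique hc

lemma zc_add_coordDir {n i : ℕ} (hi : i < n) (z : Fin n → ℝ) (t : ℝ) (l : ℕ) :
    zc (z + t • coordDir n i) l = zc z l + if l = i then t else 0 := by
  by_cases hl : l < n
  · simp [zc, coordDir, hl]
  · have : l ≠ i := by omega
    simp [zc, hl, this]

lemma IndepOfCoord.sum_pd_mul_zc_add {n m N : ℕ} {f : (Fin n → ℝ) → ℝ}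
    (h : IndepOfCoord f (m + 1)) (hmN : m < N) (hmn : m + 1 < n) (z : Fin n → ℝ) (t : ℝ) :
    ∑ i ∈ Finset.range N, pd f (z + t • coordDir n (m + 1)) i
        * zc (z + t • coordDir n (m + 1)) (i + 1) =
      (∑ i ∈ Finset.range N, pd f z i * zc z (i + 1)) + t * pd f z m := by
  simp only [h.pd_add, zc_add_coordDir hmn, mul_add, Finset.sum_add_distrib, add_left_inj]
  simp [hmN, mul_comm]

/-- If `f31 ≡ 0` and `f11'` is nowhere zero, the structure
equations with `∂F/∂z_k` nowhere zero force `∂f32/∂z_{k-1} = 0`,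
`∂f22/∂z_{k-2} = 0`, `∂f12/∂z_{k-1} = f11'(z0)·∂F/∂z_k ≠ 0`, and
`∂f32/∂z_{k-2} = −η·∂f12/∂z_{k-1} ≠ 0`. -/
theorem stmt12 (k : ℕ) (hk : 2 ≤ k) (η : ℝ) (hη : η ≠ 0)
    (f11 f31 : ℝ → ℝ) (f12 f22 f32 F : (Fin (k+1) → ℝ) → ℝ)
    (hf11 : ContDiff ℝ (⊤ : ℕ∞) f11) (hf31 : ContDiff ℝ (⊤ : ℕ∞) f31)
    (hf12 : ContDiff ℝ (⊤ : ℕ∞) f12) (hf22 : ContDiff ℝ (⊤ : ℕ∞) f22)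
    (hf32 : ContDiff ℝ (⊤ : ℕ∞) f32) (hF : ContDiff ℝ (⊤ : ℕ∞) F)
    (hdep12 : DependsOnFirst k f12) (hdep32 : DependsOnFirst k f32)
    (hdep22 : DependsOnFirst (k-1) f22)
    (hS : StructEqs k η f11 f31 f12 f22 f32 F)
    (hFk : ∀ z : Fin (k+1) → ℝ, pd F z k ≠ 0)
    (h31 : ∀ z0 : ℝ, f31 z0 = 0) (h11d : ∀ z0 : ℝ, deriv f11 z0 ≠ 0) :
    ∀ z : Fin (k+1) → ℝ,
      pd f32 z (k-1) = 0 ∧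
      pd f22 z (k-2) = 0 ∧
      (pd f12 z (k-1) = deriv f11 (z 0) * pd F z k ∧ pd f12 z (k-1) ≠ 0) ∧
      (pd f32 z (k-2) = -η * pd f12 z (k-1) ∧ pd f32 z (k-2) ≠ 0) := by
  obtain ⟨m, rfl⟩ : ∃ m, k = m + 2 := ⟨k - 2, by omega⟩
  simp only [Nat.add_sub_cancel, show m + 2 - 1 = m + 1 by omega] at *
  have hd31 : ∀ x, deriv f31 x = 0 := by simp [funext h31]
  have htop : ((⊤ : ℕ∞) : WithTop ℕ∞) ≠ 0 := by simp
  have hz0 : ∀ (z : Fin (m + 2 + 1) → ℝ) (t : ℝ) (i : ℕ),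
      (z + t • coordDir (m + 2 + 1) (i + 1)) 0 = z 0 := by
    simp [coordDir]
  have h12 := hdep12.indepOfCoord le_rfl
  have h32 := hdep32.indepOfCoord le_rfl
  have h22 := hdep22.indepOfCoord (Nat.le_succ _)
  have h22' := hdep22.indepOfCoord le_rfl
  have hpd32 : ∀ z, pd f32 z (m + 1) = 0 := by
    intro z
    have h0 := (hS z).2.2
    have h1 := (hS (z + (1 : ℝ) • coordDir _ (m + 1 + 1))).2.2
    rw [h32.sum_pd_mul_zc_add (by omega) (by omega), h12, h22, hz0, hd31] at h1
    rw [hd31] at h0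
    linarith
  have h32' := indepOfCoord_of_pd_eq_zero (hf32.differentiable htop) hpd32
  have hpd12 : ∀ z, deriv f11 (z 0) * pd F z (m + 2) = pd f12 z (m + 1) := by
    intro z
    rw [pd_eq_of_affine (hF.differentiable htop) (c := pd f12 z (m + 1) / deriv f11 (z 0)),
      mul_div_cancel₀ _ (h11d _)]
    intro t
    have h0 := (hS z).1
    have h1 := (hS (z + t • coordDir _ (m + 1 + 1))).1
    rw [h12.sum_pd_mul_zc_add (by omega) (by omega), h32, h22, hz0] at h1
    have := h11d (z 0)
    field_simp
    linarith
  intro z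
  have hne : pd f12 z (m + 1) ≠ 0 := hpd12 z ▸ mul_ne_zero (h11d _) (hFk z)
  have hlast : pd f32 z m = -η * pd f12 z (m + 1) := by
    rw [pd_eq_of_affine (hf12.differentiable htop) (c := -pd f32 z m / η)]
    · field_simp
    intro t
    have h0 := (hS z).2.2
    have h1 := (hS (z + t • coordDir _ (m + 1))).2.2
    rw [h32'.sum_pd_mul_zc_add (by omega) (by omega), h22', hz0, hd31] at h1
    rw [hd31] at h0
    field_simp
    linarith
  refine ⟨hpd32 z, ?_, ⟨(hpd12 z).symm, hne⟩, hlast, ?_⟩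
  · have h0 := (hS z).2.1
    have h1 := (hS (z + (1 : ℝ) • coordDir _ (m + 1))).2.1
    rw [h22'.sum_pd_mul_zc_add (by omega) (by omega), h32', hz0, h31] at h1
    rw [h31] at h0
    linarith
  · rw [hlast]
    exact mul_ne_zero (neg_ne_zero.mpr hη) hne
end
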